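/- arXiv:math/0311005 — 5 statements merged into one kernel-verified Lean document; each statement's English description precedes it below -/
import Mathlib

section
/- Let A be an associative unital ℂ-algebra, n ≥ 1, M an A-bimodule, and σ = (1 2 … n) ∈ S_n. Then the ℂ-linear map A^{⊗(n−1)} ⊗ M → M/[A,M] sending b₁⊗…⊗b_{n−1}⊗m to the class of b₁b₂⋯b_{n−1}m induces an isomorphism of the zeroth Hochschild homology (coinvariants) (A^{⊗(n−1)} ⊗ M)σ / [A^{⊗n}, (A^{⊗(n−1)} ⊗ M)σ] ≅ M/[A,M]. Here [A,M] denotes the ℂ-span of all commutators am − ma (a ∈ A, m ∈ M), and similarly for the A^{⊗n}-bimodule (A^{⊗(n−1)} ⊗ M)σ. -/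
open TensorProduct MulOpposite

noncomputable section

/-- The `n`-fold tensor power `A^{⊗n}` of a `ℂ`-algebra `A` (over `ℂ`),
with factorwise multiplication. -/
abbrev tpow (A : Type) [Ring A] [Algebra ℂ A] (n : ℕ) : Type := ⨂[ℂ] (_ : Fin n), A

/-- The commutator subspace `[B, P]` of a `B`-bimodule `P`: the `ℂ`-span of all
`b • p - p • b` (the right action being encoded by the `Bᵐᵒᵖ`-action). -/
def commutatorSub (B : Type) [Ring B] [Algebra ℂ B] (P : Type) [AddCommGroup P] [Module ℂ P]
    [Module B P] [Module Bᵐᵒᵖ P] : Submodule ℂ P :=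
  Submodule.span ℂ { x | ∃ (b : B) (p : P), x = b • p - op b • p }

theorem sub_op_smul_mem_commutatorSub (B : Type) [Ring B] [Algebra ℂ B] {P : Type}
    [AddCommGroup P] [Module ℂ P] [Module B P] [Module Bᵐᵒᵖ P] (b : B) (p : P) :
    b • p - op b • p ∈ commutatorSub B P :=
  Submodule.subset_span ⟨b, p, rfl⟩

theorem mk_smul_eq_mk_op_smul (B : Type) [Ring B] [Algebra ℂ B] {P : Type}
    [AddCommGroup P] [Module ℂ P] [Module B P] [Module Bᵐᵒᵖ P] (b : B) (p : P) :
    (commutatorSub B P).mkQ (b • p) = (commutatorSub B P).mkQ (op b • p) :=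
  (Submodule.Quotient.eq _).2 (sub_op_smul_mem_commutatorSub B b p)

/-- Modulo commutators, a left action following a right action can be merged into a single left
action, even if the two actions are not assumed to commute. -/
theorem mk_smul_op_smul {A : Type} [Ring A] [Algebra ℂ A] {M : Type} [AddCommGroup M]
    [Module ℂ M] [Module A M] [Module Aᵐᵒᵖ M] (x c : A) (m : M) :
    (commutatorSub A M).mkQ (x • op c • m) = (commutatorSub A M).mkQ ((c * x) • m) := by
  rw [mk_smul_eq_mk_op_smul, mk_smul_eq_mk_op_smul, op_mul, mul_smul]

theorem prod_ofFn_castSucc_mul {A : Type} [Monoid A] (n : ℕ) (a : Fin (n + 1) → A)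
    (b : Fin n → A) :
    (List.ofFn fun i : Fin n => a i.castSucc * b i).prod * a (Fin.last n)
      = a 0 * (List.ofFn fun i : Fin n => b i * a i.succ).prod := by
  induction n with
  | zero => simp
  | succ n ih =>
    have h := ih (fun i => a i.succ) (fun i => b i.succ)
    simp only [Fin.succ_castSucc, Fin.succ_last] at h
    simp only [List.ofFn_succ, List.prod_cons, Fin.castSucc_zero, mul_assoc]
    rw [h]

/-- A function invariant under shifting the last entry of a tuple onto the module only depends on
the action of the product of the tuple. -/
theorem eq_one_prod_smul_of_shift {A M Q : Type*} [Monoid A] [MulAction A M] {n : ℕ}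
    (F : (Fin n → A) → M → Q)
    (hF : ∀ b m, F b m = F (fun i => (Fin.cons 1 b : Fin (n + 1) → A) i.castSucc)
      ((Fin.cons 1 b : Fin (n + 1) → A) (Fin.last n) • m))
    (b : Fin n → A) (m : M) : F b m = F 1 ((List.ofFn b).prod • m) := by
  let g : ℕ → A := fun i => if h : n ≤ i ∧ i - n < n then b ⟨i - n, h.2⟩ else 1
  have hg1 : ∀ i, i < n → g i = 1 := fun i hi => dif_neg (by lia)
  have hgb : ∀ i : Fin n, g (n + i) = b i := fun i => by simp [g]
  have key : ∀ k, k ≤ n → ∀ m, F (fun i => g (i + k)) m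
      = F 1 ((List.ofFn fun i : Fin k => g (n + i)).prod • m) := by
    intro k
    induction k with
    | zero =>
      intro _ m
      simp only [List.ofFn_zero, List.prod_nil, one_smul]
      congr 1
      funext i
      exact hg1 _ (by simp)
    | succ k ih =>
      intro hk m
      have hcons : (Fin.cons 1 (fun i : Fin n => g (i + (k + 1))) : Fin (n + 1) → A)
          = fun i : Fin (n + 1) => g (i + k) := by
        funext i
        refine Fin.cases ?_ (fun i => ?_) i
        · simp [hg1 k (by lia)]
        · simp only [Fin.cons_succ, Fin.val_succ]
          congr 1
          lia
      rw [hF, hcons, List.ofFn_succ', List.prod_concat, mul_smul]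
      exact ih (by lia) _
  have h := key n le_rfl m
  simp only [hgb] at h
  rw [← h]
  congr 1
  funext i
  rw [← hgb, add_comm]

theorem exists_dual_tprod_one (A : Type) [Ring A] [Algebra ℂ A] [Nontrivial A] (n : ℕ) :
    ∃ f : tpow A n →ₗ[ℂ] ℂ, f (PiTensorProduct.tprod ℂ fun _ => 1) = 1 := by
  obtain ⟨l, hl⟩ := Module.Projective.exists_dual_ne_zero ℂ (one_ne_zero : (1 : A) ≠ 0)
  refine ⟨PiTensorProduct.lift ((MultilinearMap.mkPiAlgebra ℂ (Fin n) ℂ).compLinearMap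
    fun _ => (l 1)⁻¹ • l), ?_⟩
  simp [hl]

/-- If the two-or-more-fold tensor power of `A` acts on `A^{⊗(n+1)} ⊗ M` factorwise, then the
actions of `ℂ` and `A` on `M` are compatible. -/
theorem isScalarTower_of_tpow_smul (A : Type) [Ring A] [Algebra ℂ A] (n : ℕ)
    (M : Type) [AddCommGroup M] [Module ℂ M] [Module A M]
    [Module (tpow A (n + 2)) ((tpow A (n + 1)) ⊗[ℂ] M)]
    (hleft : ∀ (a : Fin (n + 2) → A) (b : Fin (n + 1) → A) (m : M),
      (PiTensorProduct.tprod ℂ a) • ((PiTensorProduct.tprod ℂ b) ⊗ₜ[ℂ] m)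
        = (PiTensorProduct.tprod ℂ (fun i : Fin (n + 1) => a i.castSucc * b i)) ⊗ₜ[ℂ]
            (a (Fin.last (n + 1)) • m)) :
    IsScalarTower ℂ A M := by
  rcases subsingleton_or_nontrivial A with hA | hA
  · have := Module.subsingleton A M
    exact ⟨fun _ _ _ => Subsingleton.elim _ _⟩
  suffices h : ∀ (c : ℂ) (m : M), (c • (1 : A)) • m = c • m from
    ⟨fun c a m => by rw [← h c (a • m), ← mul_smul, smul_one_mul]⟩
  intro c m
  obtain ⟨f, hf⟩ := exists_dual_tprod_one A (n + 1)
  have hupd : ∀ i : Fin (n + 2),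
      PiTensorProduct.tprod ℂ (Function.update (fun _ => (1 : A)) i (c • 1))
        = c • PiTensorProduct.tprod ℂ (fun _ => (1 : A)) := fun i => by
    rw [MultilinearMap.map_update_smul, Function.update_eq_self i (fun _ => (1 : A))]
  have h0 := hleft (Function.update (fun _ => (1 : A)) 0 (c • 1)) (fun _ => 1) m
  have h1 := hleft (Function.update (fun _ => (1 : A)) (Fin.last (n + 1)) (c • 1)) (fun _ => 1) m
  rw [hupd] at h0 h1
  have h := h1.symm.trans h0
  have hl : (fun i : Fin (n + 1) => Function.update (fun _ => (1 : A)) (Fin.last (n + 1)) (c • 1)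
      i.castSucc * 1) = fun _ => 1 := by
    funext i
    simp
  have hr : (fun i : Fin (n + 1) => Function.update (fun _ => (1 : A)) 0 (c • 1)
      i.castSucc * 1) = Function.update (fun _ => (1 : A)) 0 (c • 1) := by
    funext i
    refine Fin.cases ?_ (fun i => ?_) i
    · simp
    · rw [Function.update_of_ne (by simp [Fin.ext_iff]), Function.update_of_ne (by simp), mul_one]
  rw [hl, hr, MultilinearMap.map_update_smul, Function.update_eq_self 0 (fun _ => (1 : A)),
    Function.update_self, Function.update_of_ne (by simp [Fin.ext_iff]), one_smul] at h
  simpa [hf, smul_tmul'] using congrArg (TensorProduct.lid ℂ M ∘ f.rTensor M) h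

theorem exists_linearMap_tprod_tmul (A : Type) [Ring A] [Algebra ℂ A] (n : ℕ)
    (M : Type) [AddCommGroup M] [Module ℂ M] [Module A M]
    [Module (tpow A (n + 1)) ((tpow A n) ⊗[ℂ] M)]
    (hleft : ∀ (a : Fin (n + 1) → A) (b : Fin n → A) (m : M),
      (PiTensorProduct.tprod ℂ a) • ((PiTensorProduct.tprod ℂ b) ⊗ₜ[ℂ] m)
        = (PiTensorProduct.tprod ℂ (fun i : Fin n => a i.castSucc * b i)) ⊗ₜ[ℂ]
            (a (Fin.last n) • m)) :
    ∃ f : (tpow A n) ⊗[ℂ] M →ₗ[ℂ] M, ∀ (b : Fin n → A) (m : M),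
      f ((PiTensorProduct.tprod ℂ b) ⊗ₜ[ℂ] m) = (List.ofFn b).prod • m := by
  cases n with
  | zero =>
    exact ⟨(TensorProduct.congr (PiTensorProduct.isEmptyEquiv (Fin 0)) (LinearEquiv.refl ℂ M) ≪≫ₗ
      TensorProduct.lid ℂ M).toLinearMap, fun b m => by simp⟩
  | succ n =>
    have := isScalarTower_of_tpow_smul A n M hleft
    exact ⟨TensorProduct.lift ((Algebra.lsmul ℂ ℂ M).toLinearMap ∘ₗ
      PiTensorProduct.lift (MultilinearMap.mkPiAlgebraFin ℂ (n + 1) A)), fun b m => by simp [mul_smul]⟩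

/-- Let `A` be a `ℂ`-algebra, `n ≥ 1` (here the total number of tensor
factors is `n + 1`, covering exactly all `n ≥ 1`), `M` an `A`-bimodule, and
`σ = (1 2 … n+1)` the cyclic permutation.  Consider `T = A^{⊗ n} ⊗ M` with the
`σ`-twisted `A^{⊗(n+1)}`-bimodule structure
`(a₁⊗…⊗a_{n+1})·(b₁⊗…⊗b_n⊗m)·(c₁⊗…⊗c_{n+1}) = a₁b₁c₂ ⊗ … ⊗ a_n b_n c_{n+1} ⊗ a_{n+1} m c₁`
(the left and right actions are hypothesized separately below).  Then the map
`b₁⊗…⊗b_n⊗m ↦ [b₁b₂⋯b_n m]` induces a `ℂ`-linear isomorphism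
`T/[A^{⊗(n+1)}, T] ≅ M/[A, M]` of the zeroth Hochschild homologies (coinvariants). -/
theorem statement2 (A : Type) [Ring A] [Algebra ℂ A] (n : ℕ)
    (M : Type) [AddCommGroup M] [Module ℂ M] [Module A M] [Module Aᵐᵒᵖ M]
    [Module (tpow A (n + 1)) ((tpow A n) ⊗[ℂ] M)]
    [Module (tpow A (n + 1))ᵐᵒᵖ ((tpow A n) ⊗[ℂ] M)]
    (hleft : ∀ (a : Fin (n + 1) → A) (b : Fin n → A) (m : M),
      (PiTensorProduct.tprod ℂ a) • ((PiTensorProduct.tprod ℂ b) ⊗ₜ[ℂ] m)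
        = (PiTensorProduct.tprod ℂ (fun i : Fin n => a i.castSucc * b i)) ⊗ₜ[ℂ]
            (a (Fin.last n) • m))
    (hright : ∀ (c : Fin (n + 1) → A) (b : Fin n → A) (m : M),
      op (PiTensorProduct.tprod ℂ c) • ((PiTensorProduct.tprod ℂ b) ⊗ₜ[ℂ] m)
        = (PiTensorProduct.tprod ℂ (fun i : Fin n => b i * c i.succ)) ⊗ₜ[ℂ]
            (op (c 0) • m)) :
    ∃ (e : (((tpow A n) ⊗[ℂ] M) ⧸ commutatorSub (tpow A (n + 1)) ((tpow A n) ⊗[ℂ] M))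
        ≃ₗ[ℂ] (M ⧸ commutatorSub A M)),
      ∀ (b : Fin n → A) (m : M),
        e (Submodule.Quotient.mk ((PiTensorProduct.tprod ℂ b) ⊗ₜ[ℂ] m))
          = Submodule.Quotient.mk ((List.ofFn b).prod • m) := by
  obtain ⟨f, hf⟩ := exists_linearMap_tprod_tmul A n M hleft
  set C := commutatorSub (tpow A (n + 1)) ((tpow A n) ⊗[ℂ] M)
  have hfC : C ≤ (commutatorSub A M).comap f := by
    refine Submodule.span_le.2 ?_
    rintro _ ⟨t, p, rfl⟩
    rw [SetLike.mem_coe, Submodule.mem_comap, map_sub]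
    refine (Submodule.Quotient.eq _).1 ?_
    change (commutatorSub A M).mkQ (f (t • p)) = (commutatorSub A M).mkQ (f (op t • p))
    induction p using TensorProduct.induction_on with
    | zero => simp
    | add p q hp hq => simp only [smul_add, map_add, hp, hq]
    | tmul x m =>
    induction x using PiTensorProduct.induction_on with
    | add x y hx hy => simp only [add_tmul, smul_add, map_add, hx, hy]
    | smul_tprod r b =>
    rw [smul_tmul]
    induction t using PiTensorProduct.induction_on with
    | add s t hs ht => simp only [op_add, add_smul, map_add, hs, ht]
    | smul_tprod z a =>
    rw [← Function.update_eq_self 0 a, ← MultilinearMap.map_update_smul, hleft, hright, hf, hf,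
      mk_smul_op_smul, ← mul_smul, prod_ofFn_castSucc_mul]
  have hshift : ∀ (b : Fin n → A) (m : M), C.mkQ (PiTensorProduct.tprod ℂ b ⊗ₜ[ℂ] m)
      = C.mkQ (PiTensorProduct.tprod ℂ (1 : Fin n → A) ⊗ₜ[ℂ] ((List.ofFn b).prod • m)) := by
    refine eq_one_prod_smul_of_shift (fun b m => C.mkQ (PiTensorProduct.tprod ℂ b ⊗ₜ[ℂ] m))
      fun b m => ?_
    have h := mk_smul_eq_mk_op_smul (tpow A (n + 1)) (PiTensorProduct.tprod ℂ (Fin.cons 1 b))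
      (PiTensorProduct.tprod ℂ (1 : Fin n → A) ⊗ₜ[ℂ] m)
    rw [hleft, hright] at h
    simpa using h.symm
  let g : M →ₗ[ℂ] ((tpow A n) ⊗[ℂ] M) ⧸ C :=
    C.mkQ ∘ₗ TensorProduct.mk ℂ (tpow A n) M (PiTensorProduct.tprod ℂ 1)
  have hg : commutatorSub A M ≤ g.ker := by
    refine Submodule.span_le.2 ?_
    rintro _ ⟨a, m, rfl⟩
    have h := mk_smul_eq_mk_op_smul (tpow A (n + 1)) (PiTensorProduct.tprod ℂ (Fin.cons a 1))
      (PiTensorProduct.tprod ℂ (1 : Fin n → A) ⊗ₜ[ℂ] m)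
    have hp := prod_ofFn_castSucc_mul n (Fin.cons a 1 : Fin (n + 1) → A) 1
    rw [hleft, hright, hshift, ← mul_smul] at h
    simp only [Pi.one_apply] at hp h
    rw [hp] at h
    rw [SetLike.mem_coe, LinearMap.mem_ker, map_sub, sub_eq_zero]
    simpa [g, Pi.one_def] using h
  refine ⟨LinearEquiv.ofLinearMap (C.mapQ _ f hfC) ((commutatorSub A M).liftQ g hg) ?_ ?_,
    fun b m => ?_⟩
  · ext m
    simp [g, hf, Pi.one_def]
  · ext b m
    simpa [g, hf] using (hshift b m).symm
  · simp [hf]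
end
end

section
/- Let A be an associative unital ℂ-algebra that is simple, infinite-dimensional over ℂ, and has center ℂ·1. Let n ≥ 2 and let σ ∈ S_n, σ ≠ 1, act on A^{⊗n} by permuting tensor factors. Then this automorphism of A^{⊗n} is not inner: there is no invertible g ∈ A^{⊗n} such that σ(z) = g z g^{−1} for all z ∈ A^{⊗n}. -/
open TensorProduct MulOpposite

noncomputable section

theorem prod_erase_apply_update_self {A ι M : Type*} [Fintype ι] [DecidableEq ι] [CommMonoid M]
    (i : ι) (f : ι → A → M) (a : ι → A) (x : A) :
    ∏ l ∈ Finset.univ.erase i, f l (Function.update a i x l) =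
      ∏ l ∈ Finset.univ.erase i, f l (a l) :=
  Finset.prod_congr rfl fun l hl => by
    rw [Function.update_of_ne (Finset.ne_of_mem_erase hl)]

theorem prod_erase_apply_update_of_ne {A ι M : Type*} [Fintype ι] [DecidableEq ι] [CommMonoid M]
    {i k : ι} (hk : k ≠ i) (f : ι → A → M) (a : ι → A) (x : A) :
    ∏ l ∈ Finset.univ.erase i, f l (Function.update a k x l) =
      f k x * ∏ l ∈ (Finset.univ.erase i).erase k, f l (a l) := by
  rw [← Finset.mul_prod_erase _ _ (Finset.mem_erase.2 ⟨hk, Finset.mem_univ k⟩),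
    Function.update_self]
  congr 1
  exact Finset.prod_congr rfl fun l hl => by
    rw [Function.update_of_ne (Finset.ne_of_mem_erase hl)]

section sliceMap

variable {K A ι : Type*} [Field K] [Ring A] [Algebra K A] [Fintype ι] [DecidableEq ι]

/-- The contraction `⨂ a ↦ (∏ k ≠ i, f k (a k)) • a i` of a tensor power against linear functionals
in all factors but the `i`-th. -/
def sliceMap (i : ι) (f : ι → A →ₗ[K] K) : (⨂[K] _ : ι, A) →ₗ[K] A :=
  PiTensorProduct.lift
    (MultilinearMap.mk' (fun a : ι → A => (∏ k ∈ Finset.univ.erase i, f k (a k)) • a i)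
      (fun a k x y => by
        obtain rfl | hk := eq_or_ne k i
        · simp only [prod_erase_apply_update_self k (fun l => f l), Function.update_self, smul_add]
        · simp only [prod_erase_apply_update_of_ne hk (fun l => f l),
            Function.update_of_ne hk.symm, map_add, add_mul, add_smul])
      (fun a k c x => by
        obtain rfl | hk := eq_or_ne k i
        · simp only [prod_erase_apply_update_self k (fun l => f l), Function.update_self,
            smul_comm c]
        · simp only [prod_erase_apply_update_of_ne hk (fun l => f l),
            Function.update_of_ne hk.symm, map_smul, smul_eq_mul, mul_smul]))

theorem sliceMap_tprod (i : ι) (f : ι → A →ₗ[K] K) (a : ι → A) :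
    sliceMap i f (PiTensorProduct.tprod K a) =
      (∏ k ∈ Finset.univ.erase i, f k (a k)) • a i := by
  simp [sliceMap]

theorem sliceMap_tprod_mul (i : ι) (f : ι → A →ₗ[K] K) (a : ι → A) (z : ⨂[K] _ : ι, A) :
    sliceMap i f (PiTensorProduct.tprod K a * z) =
      a i * sliceMap i (fun k => f k ∘ₗ LinearMap.mulLeft K (a k)) z := by
  induction z using PiTensorProduct.induction_on with
  | smul_tprod r b =>
    simp [PiTensorProduct.tprod_mul_tprod, sliceMap_tprod]
  | add x y hx hy => simp only [mul_add, map_add, hx, hy]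

theorem sliceMap_mul_tprod_mulSingle (i : ι) (f : ι → A →ₗ[K] K) (a : A)
    (z : ⨂[K] _ : ι, A) :
    sliceMap i f (z * PiTensorProduct.tprod K (Pi.mulSingle i a)) = sliceMap i f z * a := by
  induction z using PiTensorProduct.induction_on with
  | smul_tprod r b =>
    have h : ∏ k ∈ Finset.univ.erase i, f k (b k * (Pi.mulSingle i a : ι → A) k) =
        ∏ k ∈ Finset.univ.erase i, f k (b k) :=
      Finset.prod_congr rfl fun k hk => by
        rw [Pi.mulSingle_eq_of_ne (Finset.ne_of_mem_erase hk), mul_one]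
    simp [PiTensorProduct.tprod_mul_tprod, sliceMap_tprod, h]
  | add x y hx hy => simp only [add_mul, map_add, hx, hy]

/-- For a fixed tensor, its slices in a given factor span a finite-dimensional space. -/
theorem finite_span_range_sliceMap (i : ι) (z : ⨂[K] _ : ι, A) :
    Module.Finite K (Submodule.span K (Set.range fun f : ι → A →ₗ[K] K => sliceMap i f z)) := by
  suffices h : ∃ V : Submodule K A, Module.Finite K V ∧ ∀ f, sliceMap i f z ∈ V by
    obtain ⟨V, hV, hz⟩ := h
    exact Submodule.finiteDimensional_of_le
      (Submodule.span_le.2 (Set.range_subset_iff.2 hz))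
  induction z using PiTensorProduct.induction_on with
  | smul_tprod r b =>
    refine ⟨K ∙ b i, inferInstance, fun f => ?_⟩
    rw [map_smul, sliceMap_tprod]
    exact Submodule.smul_mem _ _ (Submodule.smul_mem _ _ (Submodule.mem_span_singleton_self _))
  | add x y hx hy =>
    obtain ⟨V, hV, hx⟩ := hx
    obtain ⟨W, hW, hy⟩ := hy
    refine ⟨V ⊔ W, inferInstance, fun f => ?_⟩
    rw [map_add]
    exact add_mem (Submodule.mem_sup_left (hx f)) (Submodule.mem_sup_right (hy f))

/-- An invertible tensor has a nonzero slice in every factor. -/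
theorem exists_sliceMap_ne_zero_of_isUnit [Nontrivial A] (i : ι) {g : ⨂[K] _ : ι, A}
    (hg : IsUnit g) : ∃ f : ι → A →ₗ[K] K, sliceMap i f g ≠ 0 := by
  by_contra! h
  have hmul (z : ⨂[K] _ : ι, A) (f : ι → A →ₗ[K] K) : sliceMap i f (z * g) = 0 := by
    induction z using PiTensorProduct.induction_on with
    | smul_tprod r b => rw [smul_mul_assoc, map_smul, sliceMap_tprod_mul, h, mul_zero, smul_zero]
    | add x y hx hy => rw [add_mul, map_add, hx, hy, add_zero]
  obtain ⟨u, rfl⟩ := hg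
  obtain ⟨φ, hφ⟩ : ∃ φ : A →ₗ[K] K, φ 1 ≠ 0 := by
    by_contra! hφ
    exact one_ne_zero ((Module.forall_dual_apply_eq_zero_iff K (1 : A)).1 hφ)
  have h1 := hmul (↑u⁻¹) fun _ => φ
  rw [Units.inv_mul, PiTensorProduct.one_def, sliceMap_tprod] at h1
  simp [hφ] at h1

end sliceMap

/-- A simple algebra with a nonzero finite-dimensional subspace stable under right multiplication
is finite-dimensional. -/
theorem finite_of_finite_of_mul_mem {K A : Type*} [Field K] [Ring A] [Algebra K A]
    [IsSimpleRing A] (X : Submodule K A) [Module.Finite K X] (hX : X ≠ ⊥)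
    (hmul : ∀ x ∈ X, ∀ a : A, x * a ∈ X) : Module.Finite K A := by
  obtain ⟨x, hx, hx0⟩ := X.ne_bot_iff.1 hX
  have : Nontrivial X := ⟨⟨x, hx⟩, 0, fun h => hx0 (congrArg Subtype.val h)⟩
  let ρ : A →ₐ[K] (Module.End K X)ᵐᵒᵖ := AlgHom.ofLinearMap
    { toFun := fun a => op ((LinearMap.mulRight K a).restrict fun x hx => hmul x hx a)
      map_add' := fun a b => unop_injective <| LinearMap.ext fun y =>
        Subtype.ext (mul_add (y : A) a b)
      map_smul' := fun c a => unop_injective <| LinearMap.ext fun y =>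
        Subtype.ext (mul_smul_comm c (y : A) a) }
    (unop_injective <| LinearMap.ext fun y => Subtype.ext (mul_one (y : A)))
    (fun a b => unop_injective <| LinearMap.ext fun y => Subtype.ext (mul_assoc (y : A) a b).symm)
  exact Module.Finite.of_injective
    ((opLinearEquiv K).symm.toLinearMap ∘ₗ ρ.toLinearMap)
    ((opLinearEquiv K).symm.injective.comp ρ.toRingHom.injective)

/-- Let `A` be a simple, infinite-dimensional `ℂ`-algebra with center
`ℂ·1`.  Let `n ≥ 2` and let `σ ∈ S_n`, `σ ≠ 1`, act on `A^{⊗n}` by permuting the tensor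
factors (the algebra automorphism `ρσ` below).  Then this automorphism is not inner: there
is no invertible `g ∈ A^{⊗n}` with `σ(z) = g z g⁻¹` for all `z`. -/
theorem statement6 (A : Type) [Ring A] [Algebra ℂ A]
    (hsimple : IsSimpleRing A)
    (hinfdim : ¬ Module.Finite ℂ A)
    (hcenter : Subalgebra.center ℂ A = ⊥)
    (n : ℕ) (hn : 2 ≤ n) (σ : Equiv.Perm (Fin n)) (hσ : σ ≠ 1)
    (ρσ : tpow A n ≃ₐ[ℂ] tpow A n)
    (hρσ : ∀ a : Fin n → A,
      ρσ (PiTensorProduct.tprod ℂ a) = PiTensorProduct.tprod ℂ (fun i => a (σ⁻¹ i))) :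
    ¬ ∃ g : (tpow A n)ˣ, ∀ z : tpow A n, ρσ z = (g : tpow A n) * z * ((g⁻¹ : (tpow A n)ˣ) : tpow A n) := by
  rintro ⟨g, hg⟩
  obtain ⟨i, hi⟩ : ∃ i, σ i ≠ i := by
    by_contra! h
    exact hσ (Equiv.ext h)
  have hcomm (a : A) : (g : tpow A n) * PiTensorProduct.tprod ℂ (Pi.mulSingle i a) =
      PiTensorProduct.tprod ℂ (fun k => (Pi.mulSingle i a : Fin n → A) (σ⁻¹ k)) * (g : tpow A n) := by
    rw [← hρσ, hg, Units.inv_mul_cancel_right]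
  have := finite_span_range_sliceMap i (g : tpow A n)
  refine hinfdim (finite_of_finite_of_mul_mem
    (Submodule.span ℂ (Set.range fun f : Fin n → A →ₗ[ℂ] ℂ => sliceMap i f (g : tpow A n)))
    ?_ fun x hx a => ?_)
  · obtain ⟨f, hf⟩ := exists_sliceMap_ne_zero_of_isUnit (K := ℂ) i g.isUnit
    exact (Submodule.ne_bot_iff _).2 ⟨_, Submodule.subset_span ⟨f, rfl⟩, hf⟩
  · induction hx using Submodule.span_induction with
    | mem x hx =>
      obtain ⟨f, rfl⟩ := hx
      have hi' : σ⁻¹ i ≠ i := fun h => hi (by rw [← Equiv.Perm.eq_inv_iff_eq, h])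
      have h := sliceMap_mul_tprod_mulSingle i f a (g : tpow A n)
      rw [hcomm, sliceMap_tprod_mul, Pi.mulSingle_eq_of_ne hi', one_mul] at h
      rw [← h]
      exact Submodule.subset_span ⟨_, rfl⟩
    | zero => simp
    | add x y _ _ hx hy => rw [add_mul]; exact add_mem hx hy
    | smul c x _ hx => rw [smul_mul_assoc]; exact Submodule.smul_mem _ _ hx
end
end

section
/- Let A be an associative unital ℂ-algebra that is simple, infinite-dimensional over ℂ, and has center ℂ·1. Then for every n ≥ 1 the crossed product A(n) = ℂ[S_n] ⋉ A^{⊗n} (for the permutation action of S_n on A^{⊗n}) is a simple algebra. -/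
open TensorProduct MulOpposite

noncomputable section

section MultiplicationAlgebra

variable (K A : Type*) [Field K] [Ring A] [Algebra K A]

/-- The subalgebra of `End K A` generated by the left and right multiplications. -/
def multiplicationAlgebra : Subalgebra K (Module.End K A) :=
  Algebra.adjoin K (Set.range (LinearMap.mulLeft K) ∪ Set.range (LinearMap.mulRight K))

variable {K A}

lemma mulLeft_mem_multiplicationAlgebra (a : A) :
    LinearMap.mulLeft K a ∈ multiplicationAlgebra K A :=
  Algebra.subset_adjoin (Or.inl ⟨a, rfl⟩)

lemma mulRight_mem_multiplicationAlgebra (a : A) :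
    LinearMap.mulRight K a ∈ multiplicationAlgebra K A :=
  Algebra.subset_adjoin (Or.inr ⟨a, rfl⟩)

lemma isSimpleModule_multiplicationAlgebra [IsSimpleRing A] :
    IsSimpleModule (multiplicationAlgebra K A) A := by
  refine { eq_bot_or_eq_top := fun N ↦ or_iff_not_imp_left.2 fun hN ↦ ?_ }
  obtain ⟨x, hx, hx0⟩ := N.ne_bot_iff.1 hN
  have left (a y : A) (hy : y ∈ N) : a * y ∈ N :=
    N.smul_mem ⟨_, mulLeft_mem_multiplicationAlgebra (K := K) a⟩ hy
  have right (a y : A) (hy : y ∈ N) : y * a ∈ N :=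
    N.smul_mem ⟨_, mulRight_mem_multiplicationAlgebra (K := K) a⟩ hy
  let I : TwoSidedIdeal A := .mk' N N.zero_mem N.add_mem
    (fun {x} hx ↦ show -x ∈ N by simpa using left (-1) x hx)
    (fun {a y} hy ↦ left a y hy) (fun {y a} hy ↦ right a y hy)
  have h1 : (1 : A) ∈ I :=
    IsSimpleRing.one_mem_of_ne_zero_mem I hx0 ((TwoSidedIdeal.mem_mk' ..).2 hx)
  replace h1 : (1 : A) ∈ N := (TwoSidedIdeal.mem_mk' ..).1 h1
  exact Submodule.eq_top_iff'.2 fun a ↦ by simpa using left a 1 h1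

/-- Over a central simple algebra, every linear endomorphism agrees on any finite set with an
element of the multiplication algebra. -/
lemma exists_mem_multiplicationAlgebra_forall_eq [IsSimpleRing A]
    (hcenter : Subalgebra.center K A = ⊥) (f : Module.End K A) (s : Finset A) :
    ∃ T ∈ multiplicationAlgebra K A, ∀ x ∈ s, T x = f x := by
  have := isSimpleModule_multiplicationAlgebra (K := K) (A := A)
  have hscalar (φ : Module.End (multiplicationAlgebra K A) A) : ∃ c : K, ∀ x, φ x = c • x := by
    have left (a y : A) : φ (a * y) = a * φ y :=
      φ.map_smul ⟨_, mulLeft_mem_multiplicationAlgebra (K := K) a⟩ y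
    have right (a y : A) : φ (y * a) = φ y * a :=
      φ.map_smul ⟨_, mulRight_mem_multiplicationAlgebra (K := K) a⟩ y
    have hmem : φ 1 ∈ Subalgebra.center K A := Subalgebra.mem_center_iff.2 fun a ↦ by
      rw [← left, ← right, mul_one, one_mul]
    rw [hcenter] at hmem
    obtain ⟨c, hc⟩ := Algebra.mem_bot.1 hmem
    refine ⟨c, fun x ↦ ?_⟩
    rw [Algebra.smul_def, hc, ← right, one_mul]
  let F : Module.End (Module.End (multiplicationAlgebra K A) A) A :=
    { toFun := f
      map_add' := f.map_add
      map_smul' := fun φ x ↦ by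
        obtain ⟨c, hc⟩ := hscalar φ
        simp [hc] }
  obtain ⟨T, hT⟩ := jacobson_density (R := multiplicationAlgebra K A) (M := A) F s
  exact ⟨T, T.2, fun x hx ↦ (hT x hx).symm⟩

end MultiplicationAlgebra

section PiTensorProduct

open PiTensorProduct

variable {ι K A : Type*} [Field K] [Ring A] [Algebra K A]

lemma exists_finset_map_eq_map [Finite ι] (x : ⨂[K] _ : ι, A) : ∃ s : Finset A,
    ∀ T T' : ι → Module.End K A, (∀ i, ∀ y ∈ s, T i y = T' i y) →
      PiTensorProduct.map T x = PiTensorProduct.map T' x := by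
  classical
  have := Fintype.ofFinite ι
  induction x using PiTensorProduct.induction_on with
  | smul_tprod r a =>
    refine ⟨Finset.univ.image a, fun T T' h ↦ ?_⟩
    rw [map_smul, map_smul, map_tprod, map_tprod]
    congr 2
    exact funext fun i ↦ h i _ (Finset.mem_image_of_mem _ (Finset.mem_univ i))
  | add x y hx hy =>
    obtain ⟨s, hs⟩ := hx
    obtain ⟨t, ht⟩ := hy
    refine ⟨s ∪ t, fun T T' h ↦ ?_⟩
    rw [map_add, map_add, hs T T' fun i y hy ↦ h i y (Finset.mem_union_left _ hy),
      ht T T' fun i y hy ↦ h i y (Finset.mem_union_right _ hy)]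

lemma exists_finiteDimensional_forall_map_mem [Finite ι] [DecidableEq ι] (i : ι)
    (x : ⨂[K] _ : ι, A) :
    ∃ F : Submodule K (⨂[K] _ : ι, A), FiniteDimensional K F ∧ ∀ f : ι → Module.Dual K A,
      PiTensorProduct.map (Function.update (fun k ↦ (f k).smulRight (1 : A)) i .id) x ∈ F := by
  have := Fintype.ofFinite ι
  induction x using PiTensorProduct.induction_on with
  | smul_tprod r a =>
    refine ⟨K ∙ singleAlgHom (R := K) (A := fun _ ↦ A) i (a i), inferInstance, fun f ↦ ?_⟩
    rw [map_smul, map_tprod]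
    refine Submodule.smul_mem _ _ (Submodule.mem_span_singleton.2
      ⟨∏ k, if k = i then 1 else f k (a k), ?_⟩)
    rw [singleAlgHom_apply, ← MultilinearMap.map_smul_univ]
    congr 1
    ext k
    obtain rfl | hk := eq_or_ne k i <;> simp [*]
  | add x y hx hy =>
    obtain ⟨F, hF, hF'⟩ := hx
    obtain ⟨G, hG, hG'⟩ := hy
    refine ⟨F ⊔ G, inferInstance, fun f ↦ ?_⟩
    rw [map_add]
    exact Submodule.add_mem_sup (hF' f) (hG' f)

lemma exists_map_smulRight_one_eq_smul_one [Finite ι] {x : ⨂[K] _ : ι, A} (hx : x ≠ 0) :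
    ∃ f : ι → Module.Dual K A, ∃ c : K, c ≠ 0 ∧
      PiTensorProduct.map (fun i ↦ (f i).smulRight (1 : A)) x = c • 1 := by
  have := Fintype.ofFinite ι
  let b := Module.Basis.ofVectorSpace K A
  let B := Basis.piTensorProduct (fun _ : ι ↦ b)
  obtain ⟨p, hp⟩ : ∃ p, B.repr x p ≠ 0 := by
    by_contra! h
    exact hx (B.ext_elem fun p ↦ by simp [h p])
  refine ⟨fun i ↦ b.coord (p i), B.repr x p, hp, ?_⟩
  have h : PiTensorProduct.map (fun i ↦ (b.coord (p i)).smulRight (1 : A)) =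
      (B.coord p).smulRight (1 : ⨂[K] _ : ι, A) := by
    ext a
    simp only [LinearMap.compMultilinearMap_apply, map_tprod, LinearMap.smulRight_apply,
      Module.Basis.coord_apply, B, Basis.piTensorProduct_repr_tprod_apply, one_def]
    rw [← MultilinearMap.map_smul_univ]
    rfl
  rw [h]
  rfl

lemma nontrivial_piTensorProduct [Finite ι] [Nontrivial A] : Nontrivial (⨂[K] _ : ι, A) := by
  let b := Module.Basis.ofVectorSpace K A
  have := b.index_nonempty
  exact (Basis.piTensorProduct (fun _ : ι ↦ b)).repr.toEquiv.nontrivial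

lemma map_mem_of_mem_multiplicationAlgebra [Finite ι] (I : TwoSidedIdeal (⨂[K] _ : ι, A))
    {T : ι → Module.End K A} (hT : ∀ i, T i ∈ multiplicationAlgebra K A) {x : ⨂[K] _ : ι, A}
    (hx : x ∈ I) : PiTensorProduct.map T x ∈ I := by
  classical
  have := Fintype.ofFinite ι
  have smul_mem (c : K) {y} (hy : y ∈ I) : c • y ∈ I := by
    rw [Algebra.smul_def]
    exact I.mul_mem_left _ _ hy
  have single (i : ι) (S : Module.End K A) (hS : S ∈ multiplicationAlgebra K A) :
      ∀ y ∈ I, PiTensorProduct.map (Function.update 1 i S) y ∈ I := by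
    induction hS using Algebra.adjoin_induction with
    | mem S hS =>
      intro y hy
      obtain ⟨a, rfl⟩ | ⟨a, rfl⟩ := hS
      · have h : PiTensorProduct.map (Function.update 1 i (LinearMap.mulLeft K a)) =
            LinearMap.mulLeft K (singleAlgHom (R := K) (A := fun _ ↦ A) i a) := by
          ext z
          simp only [LinearMap.compMultilinearMap_apply, map_tprod, LinearMap.mulLeft_apply,
            singleAlgHom_apply, tprod_mul_tprod]
          congr 1
          ext k
          obtain rfl | hk := eq_or_ne k i <;> simp [*]
        rw [h, LinearMap.mulLeft_apply]
        exact I.mul_mem_left _ _ hy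
      · have h : PiTensorProduct.map (Function.update 1 i (LinearMap.mulRight K a)) =
            LinearMap.mulRight K (singleAlgHom (R := K) (A := fun _ ↦ A) i a) := by
          ext z
          simp only [LinearMap.compMultilinearMap_apply, map_tprod, LinearMap.mulRight_apply,
            singleAlgHom_apply, tprod_mul_tprod]
          congr 1
          ext k
          obtain rfl | hk := eq_or_ne k i <;> simp [*]
        rw [h, LinearMap.mulRight_apply]
        exact I.mul_mem_right _ _ hy
    | algebraMap r =>
      intro y hy
      rw [Algebra.algebraMap_eq_smul_one, PiTensorProduct.map_update_smul,
        Function.update_eq_self_iff.2 (Pi.one_apply i).symm]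
      simpa [PiTensorProduct.map_one, Pi.one_def] using smul_mem r hy
    | add S S' _ _ h h' =>
      intro y hy
      rw [PiTensorProduct.map_update_add]
      exact I.add_mem (h y hy) (h' y hy)
    | mul S S' _ _ h h' =>
      intro y hy
      have hmul : (Function.update 1 i (S * S') : ι → Module.End K A) =
          fun k ↦ (Function.update 1 i S : ι → Module.End K A) k *
            (Function.update 1 i S' : ι → Module.End K A) k := by
        ext1 k
        obtain rfl | hk := eq_or_ne k i <;> simp [*]
      rw [hmul, PiTensorProduct.map_mul]
      exact h _ (h' _ hy)
  have key (s : Finset ι) : PiTensorProduct.map (fun i ↦ if i ∈ s then T i else 1) x ∈ I := by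
    induction s using Finset.induction_on with
    | empty => simpa [PiTensorProduct.map_one] using hx
    | insert i s hi ih =>
      have hmul : (fun k ↦ if k ∈ insert i s then T k else 1) =
          fun k ↦ (Function.update 1 i (T i) : ι → Module.End K A) k * if k ∈ s then T k else 1 := by
        ext1 k
        obtain rfl | hk := eq_or_ne k i <;> simp [*]
      rw [hmul, PiTensorProduct.map_mul]
      exact single i _ (hT i) _ ih
  simpa using key Finset.univ

/-- A finite tensor power of a central simple algebra is simple. -/
theorem isSimpleRing_piTensorProduct [Finite ι] [IsSimpleRing A]
    (hcenter : Subalgebra.center K A = ⊥) : IsSimpleRing (⨂[K] _ : ι, A) := by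
  have := nontrivial_piTensorProduct (ι := ι) (K := K) (A := A)
  refine .of_eq_bot_or_eq_top fun I ↦ or_iff_not_imp_left.2 fun hI ↦ ?_
  obtain ⟨x, hxI, hx⟩ : ∃ x ∈ I, x ≠ 0 := by
    by_contra! h
    exact hI (eq_bot_iff.2 fun x hx ↦ (TwoSidedIdeal.mem_bot _).2 (h x hx))
  obtain ⟨f, c, hc, hfx⟩ := exists_map_smulRight_one_eq_smul_one hx
  obtain ⟨s, hs⟩ := exists_finset_map_eq_map x
  choose T hT hTs using fun i ↦
    exists_mem_multiplicationAlgebra_forall_eq hcenter ((f i).smulRight (1 : A)) s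
  have hmem := map_mem_of_mem_multiplicationAlgebra I hT hxI
  rw [hs T _ hTs, hfx] at hmem
  rw [← TwoSidedIdeal.one_mem_iff]
  have := I.mul_mem_left (algebraMap K _ c⁻¹) _ hmem
  rwa [← Algebra.smul_def, smul_smul, inv_mul_cancel₀ hc, one_smul] at this

/-- In a finite tensor power of an infinite-dimensional simple algebra, no nonzero element
intertwines two distinct tensor factors. -/
theorem eq_zero_of_forall_single_mul_eq_mul_single [Finite ι] [DecidableEq ι] [IsSimpleRing A]
    (hinf : ¬ Module.Finite K A) {i j : ι} (hij : i ≠ j) (x : ⨂[K] _ : ι, A)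
    (hx : ∀ a : A, singleAlgHom (R := K) (A := fun _ ↦ A) i a * x =
      x * singleAlgHom (R := K) (A := fun _ ↦ A) j a) : x = 0 := by
  by_contra hx0
  let slice (f : ι → Module.Dual K A) : Module.End K (⨂[K] _ : ι, A) :=
    PiTensorProduct.map (Function.update (fun k ↦ (f k).smulRight (1 : A)) i .id)
  let V : Submodule K (⨂[K] _ : ι, A) := .span K (Set.range fun f ↦ slice f x)
  have slice_left (f : ι → Module.Dual K A) (a : A) (y : ⨂[K] _ : ι, A) :
      slice f (singleAlgHom (R := K) (A := fun _ ↦ A) i a * y) =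
        singleAlgHom (R := K) (A := fun _ ↦ A) i a * slice f y := by
    suffices slice f ∘ₗ LinearMap.mulLeft K (singleAlgHom (R := K) (A := fun _ ↦ A) i a) =
        LinearMap.mulLeft K (singleAlgHom (R := K) (A := fun _ ↦ A) i a) ∘ₗ slice f from
      LinearMap.congr_fun this y
    ext z
    simp only [slice, LinearMap.compMultilinearMap_apply, LinearMap.comp_apply, map_tprod,
      LinearMap.mulLeft_apply, singleAlgHom_apply, tprod_mul_tprod]
    congr 1
    ext k
    obtain rfl | hk := eq_or_ne k i <;> simp [*]
  have slice_right (f : ι → Module.Dual K A) (a : A) (y : ⨂[K] _ : ι, A) :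
      slice f (y * singleAlgHom (R := K) (A := fun _ ↦ A) j a) =
        slice (Function.update f j (f j ∘ₗ LinearMap.mulRight K a)) y := by
    suffices slice f ∘ₗ LinearMap.mulRight K (singleAlgHom (R := K) (A := fun _ ↦ A) j a) =
        slice (Function.update f j (f j ∘ₗ LinearMap.mulRight K a)) from
      LinearMap.congr_fun this y
    ext z
    simp only [slice, LinearMap.compMultilinearMap_apply, LinearMap.comp_apply, map_tprod,
      LinearMap.mulRight_apply, singleAlgHom_apply, tprod_mul_tprod]
    congr 1
    ext k
    obtain rfl | hk := eq_or_ne k i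
    · simp [hij]
    · obtain rfl | hk' := eq_or_ne k j <;> simp [*]
  have hV (a : A) (v : ⨂[K] _ : ι, A) (hv : v ∈ V) :
      singleAlgHom (R := K) (A := fun _ ↦ A) i a * v ∈ V := by
    suffices V ≤ V.comap (LinearMap.mulLeft K (singleAlgHom (R := K) (A := fun _ ↦ A) i a)) from
      this hv
    refine Submodule.span_le.2 ?_
    rintro _ ⟨f, rfl⟩
    refine Submodule.subset_span
      ⟨Function.update f j (f j ∘ₗ LinearMap.mulRight K a), ?_⟩
    simp only [LinearMap.mulLeft_apply]
    rw [← slice_left, hx, slice_right]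
  have hVfin : FiniteDimensional K V := by
    obtain ⟨F, hF, hF'⟩ := exists_finiteDimensional_forall_map_mem i x
    refine Submodule.finiteDimensional_of_le (S₂ := F) (Submodule.span_le.2 ?_)
    rintro _ ⟨f, rfl⟩
    exact hF' f
  have hVnontrivial : Nontrivial V := by
    obtain ⟨f, c, hc, hfx⟩ := exists_map_smulRight_one_eq_smul_one hx0
    have := nontrivial_piTensorProduct (ι := ι) (K := K) (A := A)
    have hne : slice f x ≠ 0 := fun h0 ↦ by
      have hcomp : PiTensorProduct.map (fun k ↦ (f k).smulRight (1 : A)) =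
          PiTensorProduct.map (Function.update 1 i ((f i).smulRight (1 : A))) * slice f := by
        rw [← PiTensorProduct.map_mul]
        congr 1
        ext k : 1
        obtain rfl | hk := eq_or_ne k i
        · simp [← Module.End.one_eq_id]
        · simp [*]
      rw [hcomp, Module.End.mul_apply, h0, map_zero] at hfx
      exact smul_ne_zero hc one_ne_zero hfx.symm
    exact ⟨⟨⟨slice f x, Submodule.subset_span ⟨f, rfl⟩⟩, 0, fun h ↦ hne (congrArg Subtype.val h)⟩⟩
  let φ := singleAlgHom (R := K) (A := fun _ ↦ A) i
  let L : A →ₐ[K] Module.End K V :=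
    AlgHom.ofLinearMap
      { toFun := fun a ↦ (LinearMap.mulLeft K (φ a)).restrict (hV a)
        map_add' := fun a b ↦ LinearMap.ext fun v ↦ Subtype.ext <|
          show φ (a + b) * v = φ a * v + φ b * v by rw [map_add, add_mul]
        map_smul' := fun c a ↦ LinearMap.ext fun v ↦ Subtype.ext <|
          show φ (c • a) * v = c • (φ a * v) by rw [map_smul, smul_mul_assoc] }
      (LinearMap.ext fun v ↦ Subtype.ext <|
        show φ 1 * (v : ⨂[K] _ : ι, A) = v by rw [map_one, one_mul])
      (fun a b ↦ LinearMap.ext fun v ↦ Subtype.ext <|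
        show φ (a * b) * (v : ⨂[K] _ : ι, A) = φ a * (φ b * v) by rw [map_mul, mul_assoc])
  have hL : Function.Injective L.toLinearMap := RingHom.injective L.toRingHom
  exact hinf (Module.Finite.of_injective L.toLinearMap hL)

end PiTensorProduct

section CrossedProduct

variable {R G D : Type*} [Ring R] [Group G] [Ring D]

/-- A crossed product of a simple ring by a group is simple if no nonzero element of the ring
intertwines the identity with the automorphism attached to a nontrivial group element. -/
theorem isSimpleRing_of_crossedProduct [IsSimpleRing R] (ρ : G →* (R ≃+* R))
    (hρ : ∀ g ≠ 1, ∀ b : R, (∀ x, b * ρ g x = x * b) → b = 0)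
    (e : MonoidAlgebra R G ≃+ D)
    (he : ∀ (g h : G) (a b : R), e (.single g a) * e (.single h b) =
      e (.single (g * h) (a * ρ g b))) : IsSimpleRing D := by
  classical
  have one_mul_e (d : D) : e (.single 1 1) * d = d := by
    obtain ⟨y, rfl⟩ := e.surjective d
    induction y using MonoidAlgebra.induction_linear with
    | zero => simp
    | add y z hy hz => rw [map_add, mul_add, hy, hz]
    | single g a => simp [he]
  have e_one : e (.single 1 1) = 1 := by rw [← one_mul_e 1, mul_one]
  let c (d : D) : G →₀ R := (e.symm d).coeff
  have c_add (d d' : D) (h : G) : c (d + d') h = c d h + c d' h := by simp [c]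
  have c_sub (d d' : D) (h : G) : c (d - d') h = c d h - c d' h := by simp [c]
  have c_left (a : R) (d : D) (h : G) : c (e (.single 1 a) * d) h = a * c d h := by
    obtain ⟨y, rfl⟩ := e.surjective d
    induction y using MonoidAlgebra.induction_linear with
    | zero => simp [c]
    | add y z hy hz => simp_all [c, mul_add]
    | single g b =>
      simp only [c, he, AddEquiv.symm_apply_apply]
      obtain rfl | hg := eq_or_ne g h <;> simp [*]
  have c_right (a : R) (d : D) (h : G) : c (d * e (.single 1 a)) h = c d h * ρ h a := by
    obtain ⟨y, rfl⟩ := e.surjective d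
    induction y using MonoidAlgebra.induction_linear with
    | zero => simp [c]
    | add y z hy hz => simp_all [c, add_mul]
    | single g b =>
      simp only [c, he, AddEquiv.symm_apply_apply]
      obtain rfl | hg := eq_or_ne g h <;> simp [*]
  have : Nontrivial D := e.symm.toEquiv.nontrivial
  refine .of_eq_bot_or_eq_top fun J ↦ or_iff_not_imp_left.2 fun hJ ↦ ?_
  rw [← TwoSidedIdeal.one_mem_iff]
  obtain ⟨u, ⟨huJ, hu0⟩, hmin⟩ : ∃ u, (u ∈ J ∧ u ≠ 0) ∧ ∀ v, v ∈ J ∧ v ≠ 0 →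
      (c u).support.card ≤ (c v).support.card := by
    obtain ⟨x, hx⟩ : ∃ x, x ∈ J ∧ x ≠ 0 := by
      by_contra! h
      exact hJ (eq_bot_iff.2 fun x hx ↦ (TwoSidedIdeal.mem_bot _).2 (h x hx))
    have hwf := (measure fun d : D ↦ (c d).support.card).wf
    obtain ⟨u, hu, hmin⟩ := hwf.has_min {d | d ∈ J ∧ d ≠ 0} ⟨x, hx⟩
    exact ⟨u, hu, fun v hv ↦ not_lt.1 (hmin v hv)⟩
  have eq_zero (v : D) (hv : v ∈ J) (g : G) (hg : g ∈ (c u).support)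
      (hsub : ∀ h, c u h = 0 → c v h = 0) (hvg : c v g = 0) : v = 0 := by
    by_contra hv0
    refine (hmin v ⟨hv, hv0⟩).not_gt (Finset.card_lt_card ?_)
    refine (Finset.ssubset_iff_of_subset fun h ↦ ?_).2 ⟨g, hg, by simpa using hvg⟩
    simpa using mt (hsub h)
  obtain ⟨g, hg⟩ : (c u).support.Nonempty := by
    rw [Finsupp.support_nonempty_iff]
    simpa [c] using hu0
  let I : TwoSidedIdeal R := .mk' {r | ∃ d ∈ J, (∀ h, c u h = 0 → c d h = 0) ∧ c d g = r}
    ⟨0, J.zero_mem, by simp [c], by simp [c]⟩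
    (by
      rintro _ _ ⟨d, hd, hds, rfl⟩ ⟨d', hd', hds', rfl⟩
      exact ⟨d + d', J.add_mem hd hd', fun h hh ↦ by rw [c_add, hds h hh, hds' h hh, add_zero],
        by simp [c]⟩)
    (by
      rintro _ ⟨d, hd, hds, rfl⟩
      exact ⟨-d, J.neg_mem hd, fun h hh ↦ by simpa [c] using hds h hh, by simp [c]⟩)
    (by
      rintro a _ ⟨d, hd, hds, rfl⟩
      exact ⟨e (.single 1 a) * d, J.mul_mem_left _ _ hd,
        fun h hh ↦ by rw [c_left, hds h hh, mul_zero], c_left ..⟩)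
    (by
      rintro _ a ⟨d, hd, hds, rfl⟩
      exact ⟨d * e (.single 1 ((ρ g).symm a)), J.mul_mem_right _ _ hd,
        fun h hh ↦ by rw [c_right, hds h hh, zero_mul], by simp [c_right]⟩)
  have hI : (1 : R) ∈ I := IsSimpleRing.one_mem_of_ne_zero_mem I (Finsupp.mem_support_iff.1 hg)
    ((TwoSidedIdeal.mem_mk' ..).2 ⟨u, huJ, fun _ h ↦ h, rfl⟩)
  obtain ⟨d, hdJ, hds, hdg⟩ := (TwoSidedIdeal.mem_mk' ..).1 hI
  have hcomm (x : R) : e (.single 1 x) * d - d * e (.single 1 ((ρ g).symm x)) = 0 :=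
    eq_zero _ (J.sub_mem (J.mul_mem_left _ _ hdJ) (J.mul_mem_right _ _ hdJ)) g hg
      (fun h hh ↦ by simp [c_sub, c_left, c_right, hds h hh])
      (by simp [c_sub, c_left, c_right, hdg])
  have hd : d = e (.single g 1) := by
    apply e.symm.injective
    ext h
    change c d h = _
    obtain rfl | hh := eq_or_ne h g
    · simp [hdg]
    · rw [hρ (h * g⁻¹) (by rwa [Ne, mul_inv_eq_one]) (c d h)]
      · simp [hh.symm]
      · intro x
        have := c_sub (e (.single 1 x) * d) (d * e (.single 1 ((ρ g).symm x))) h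
        rw [hcomm, c_left, c_right, show c 0 h = 0 by simp [c]] at this
        simpa using (sub_eq_zero.1 this.symm).symm
  have := J.mul_mem_right d (e (.single g⁻¹ 1)) hdJ
  rwa [hd, he, map_one, mul_one, mul_inv_cancel, e_one] at this

end CrossedProduct

/-- Let `A` be a simple, infinite-dimensional `ℂ`-algebra with center
`ℂ·1`, and `n ≥ 1`.  Let `S_n` act on `A^{⊗n}` by permuting tensor factors (the action
`ρ`, an algebra automorphism for each permutation, characterized on pure tensors by
`hρ`), and let `D = ℂ[S_n] ⋉ A^{⊗n}` be the crossed product: as a `ℂ`-vector space it is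
`A^{⊗n} ⊗ ℂ[S_n]` (identified with `MonoidAlgebra (A^{⊗n}) S_n` via the `ℂ`-linear
equivalence `e`, with `a ⊗ g ↔ single g a`), and its multiplication is
`(a ⊗ g)(b ⊗ h) = a·g(b) ⊗ gh`.  Then `D` is a simple algebra. -/
theorem statement7 (A : Type) [Ring A] [Algebra ℂ A]
    (hsimple : IsSimpleRing A)
    (hinfdim : ¬ Module.Finite ℂ A)
    (hcenter : Subalgebra.center ℂ A = ⊥)
    (n : ℕ) (hn : 1 ≤ n)
    (ρ : Equiv.Perm (Fin n) →* (tpow A n ≃ₐ[ℂ] tpow A n))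
    (hρ : ∀ (σ : Equiv.Perm (Fin n)) (a : Fin n → A),
      ρ σ (PiTensorProduct.tprod ℂ a) = PiTensorProduct.tprod ℂ (fun i => a (σ⁻¹ i)))
    (D : Type) [Ring D] [Algebra ℂ D]
    (e : MonoidAlgebra (tpow A n) (Equiv.Perm (Fin n)) ≃ₗ[ℂ] D)
    (he : ∀ (g h : Equiv.Perm (Fin n)) (a b : tpow A n),
      e (MonoidAlgebra.single g a) * e (MonoidAlgebra.single h b)
        = e (MonoidAlgebra.single (g * h) (a * ρ g b))) :
    IsSimpleRing D := by
  have := isSimpleRing_piTensorProduct (ι := Fin n) hcenter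
  let toRingEquiv : (tpow A n ≃ₐ[ℂ] tpow A n) →* (tpow A n ≃+* tpow A n) :=
    { toFun := fun f ↦ f.toRingEquiv
      map_one' := rfl
      map_mul' := fun _ _ ↦ rfl }
  refine isSimpleRing_of_crossedProduct (toRingEquiv.comp ρ) (fun g hg b hb ↦ ?_) e.toAddEquiv he
  obtain ⟨j, hj⟩ : ∃ j, g j ≠ j := by
    by_contra! h
    exact hg (Equiv.ext h)
  refine eq_zero_of_forall_single_mul_eq_mul_single hinfdim hj.symm b fun a ↦ ?_
  rw [← hb]
  congr 1
  change ρ g _ = _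
  rw [PiTensorProduct.singleAlgHom_apply, PiTensorProduct.singleAlgHom_apply, hρ]
  congr 1
  ext k
  obtain rfl | hk := eq_or_ne k (g j)
  · simp
  · have hk' : g⁻¹ k ≠ j := fun h ↦ hk (by simp [← h])
    rw [MonoidHom.mulSingle_apply, MonoidHom.mulSingle_apply, Pi.mulSingle_eq_of_ne hk',
      Pi.mulSingle_eq_of_ne hk]
end
end

section
/- Let 𝒜 be the Weyl algebra. Then the Hochschild cohomology of 𝒜 satisfies: HH^0(𝒜) ≅ ℂ, and HH^i(𝒜) = 0 for all i ≠ 0. -/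
open TensorProduct CategoryTheory MulOpposite

noncomputable section

/-- The enveloping algebra `S ⊗[ℂ] Sᵐᵒᵖ` of a `ℂ`-algebra `S`. -/
abbrev env (S : Type) [Ring S] [Algebra ℂ S] : Type := S ⊗[ℂ] Sᵐᵒᵖ

/-- `S` as a left module over its enveloping algebra (via `(x ⊗ yᵒᵖ) • s = x * s * y`). -/
abbrev envBimod (S : Type) [Ring S] [Algebra ℂ S] : ModuleCat (env S) :=
  @ModuleCat.of (env S) _ S _ (TensorProduct.Algebra.module)

/-- Hochschild cohomology with coefficients: `HH^i(S, N) = Ext^i_{S^e}(S, N)`. -/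
abbrev HHext (S : Type) [Ring S] [Algebra ℂ S] (i : ℕ) (N : ModuleCat (env S)) : ModuleCat ℂ :=
  ((Ext ℂ (ModuleCat (env S)) i).obj (Opposite.op (envBimod S))).obj N

/-- Hochschild cohomology `HH^i(S) = Ext^i_{S^e}(S, S)`. -/
abbrev HHcoh (S : Type) [Ring S] [Algebra ℂ S] (i : ℕ) : ModuleCat ℂ :=
  HHext S i (envBimod S)

/-- The defining relation of the Weyl algebra: `x p = p x + 1`
(generators: `0 ↦ x`, `1 ↦ p`). -/
inductive weylRel : FreeAlgebra ℂ (Fin 2) → FreeAlgebra ℂ (Fin 2) → Prop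
  | rel : weylRel (FreeAlgebra.ι ℂ 0 * FreeAlgebra.ι ℂ 1)
      (FreeAlgebra.ι ℂ 1 * FreeAlgebra.ι ℂ 0 + 1)

/-- The Weyl algebra `𝒜`: the quotient of the free algebra on `x, p`
by the two-sided ideal generated by `xp - px - 1`. -/
abbrev Weyl : Type := RingQuot weylRel

/-- The generator `x` of the Weyl algebra. -/
def Weyl.x : Weyl := RingQuot.mkAlgHom ℂ weylRel (FreeAlgebra.ι ℂ 0)

/-- The generator `p` of the Weyl algebra. -/
def Weyl.p : Weyl := RingQuot.mkAlgHom ℂ weylRel (FreeAlgebra.ι ℂ 1)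

namespace KoszulTwo

variable {E : Type} [Ring E] (X P : E)

/-- The modules of the length two Koszul complex of two commuting elements. -/
def obj (E : Type) [Ring E] : ℕ → ModuleCat.{0} E
  | 0 => ModuleCat.of E E
  | 1 => ModuleCat.of E (E × E)
  | 2 => ModuleCat.of E E
  | _ + 3 => ModuleCat.of E PUnit

/-- The first differential `(a, b) ↦ a X + b P`. -/
def dOne : E × E →ₗ[E] E :=
  (LinearMap.toSpanSingleton E E X).coprod (LinearMap.toSpanSingleton E E P)

/-- The second differential `e ↦ (e P, -e X)`. -/
def dTwo : E →ₗ[E] E × E :=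
  (LinearMap.toSpanSingleton E E P).prod (LinearMap.toSpanSingleton E E (-X))

@[simp]
lemma dOne_apply (a : E × E) : dOne X P a = a.1 * X + a.2 * P := by simp [dOne]

@[simp]
lemma dTwo_apply (e : E) : dTwo X P e = (e * P, -(e * X)) := by simp [dTwo]

/-- The differentials of the length two Koszul complex. -/
def d : ∀ n, obj E (n + 1) ⟶ obj E n
  | 0 => ModuleCat.ofHom (dOne X P)
  | 1 => ModuleCat.ofHom (dTwo X P)
  | _ + 2 => 0

variable {X P}

lemma d_comp_d (h : Commute X P) : ∀ n, d X P (n + 1) ≫ d X P n = 0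
  | 0 => by
    ext
    change dOne X P (dTwo X P 1) = 0
    simp [h.eq]
  | _ + 1 => Limits.zero_comp

/-- The length two Koszul complex of commuting elements `X`, `P` acting on `E` from the right. -/
def complex (h : Commute X P) : ChainComplex (ModuleCat.{0} E) ℕ :=
  ChainComplex.of (obj E) (d X P) (d_comp_d h)

lemma complex_d (h : Commute X P) (n : ℕ) : (complex h).d (n + 1) n = d X P n :=
  ChainComplex.of_d _ _ _

instance projective_obj (n : ℕ) : Projective (obj E n) := by
  match n with
  | 0 => exact inferInstanceAs (Projective (ModuleCat.of E E))
  | 1 => exact inferInstanceAs (Projective (ModuleCat.of E (E × E)))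
  | 2 => exact inferInstanceAs (Projective (ModuleCat.of E E))
  | n + 3 => exact inferInstanceAs (Projective (ModuleCat.of E PUnit))

variable (X P) in
/-- The Koszul complex of right multiplication by the commuting elements `X`, `P` is a resolution
of `M`, with augmentation `e ↦ e • m₀`. -/
structure IsResolution {M : ModuleCat.{0} E} (m₀ : M) : Prop where
  comm : Commute X P
  eq_zero_of_mul : ∀ e : E, e * P = 0 → e = 0
  exists_of_add_eq_zero : ∀ a b : E, a * X + b * P = 0 → ∃ e, a = e * P ∧ b = -(e * X)
  smul_left : X • m₀ = 0
  smul_right : P • m₀ = 0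
  exists_of_smul_eq_zero : ∀ e : E, e • m₀ = 0 → ∃ a b, e = a * X + b * P
  surjective : ∀ m : M, ∃ e : E, e • m₀ = m

variable {M : ModuleCat.{0} E} {m₀ : M}

/-- The augmentation. -/
def aug (m₀ : M) : obj E 0 ⟶ M := ModuleCat.ofHom (LinearMap.toSpanSingleton E M m₀)

lemma d_comp_aug (h : IsResolution X P m₀) : d X P 0 ≫ aug m₀ = 0 := by
  ext (a : E × E)
  change (dOne X P a) • m₀ = 0
  simp [add_smul, mul_smul, h.smul_left, h.smul_right]

lemma exactAt_succ (h : IsResolution X P m₀) (n : ℕ) : (complex h.comm).ExactAt (n + 1) := by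
  rw [HomologicalComplex.exactAt_iff' _ (n + 1 + 1) (n + 1) n (by simp) (by simp),
    ShortComplex.moduleCat_exact_iff]
  change ∀ x : obj E (n + 1), (complex h.comm).d (n + 1) n x = 0 →
    ∃ y : obj E (n + 2), (complex h.comm).d (n + 1 + 1) (n + 1) y = x
  rw [complex_d, complex_d]
  match n with
  | 0 =>
    rintro ⟨a, b⟩ hx
    obtain ⟨e, rfl, rfl⟩ := h.exists_of_add_eq_zero a b ((dOne_apply X P _).symm.trans hx)
    exact ⟨e, dTwo_apply X P e⟩
  | 1 =>
    intro (x : E) hx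
    have := (dTwo_apply X P x).symm.trans hx
    refine ⟨0, (map_zero _).trans (h.eq_zero_of_mul x (congrArg Prod.fst this)).symm⟩
  | n + 2 => exact fun x _ => ⟨0, Subsingleton.elim (α := PUnit) _ _⟩

lemma exact_aug (h : IsResolution X P m₀) :
    (ShortComplex.mk _ _ (d_comp_aug h)).Exact ∧ Epi (ShortComplex.mk _ _ (d_comp_aug h)).g := by
  rw [ShortComplex.moduleCat_exact_iff, ModuleCat.epi_iff_surjective]
  refine ⟨fun e he => ?_, h.surjective⟩
  obtain ⟨a, b, hab⟩ := h.exists_of_smul_eq_zero e he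
  exact ⟨(a, b), (dOne_apply X P _).trans hab.symm⟩

/-- The Koszul complex as a projective resolution. -/
def resolution (h : IsResolution X P m₀) : ProjectiveResolution M where
  complex := complex h.comm
  projective n := projective_obj n
  π := (ChainComplex.toSingle₀Equiv _ _).symm
    ⟨aug m₀, by rw [complex_d]; exact d_comp_aug h⟩
  quasiIso := ⟨fun n => by
    cases n with
    | zero =>
      rw [ChainComplex.quasiIsoAt₀_iff, ShortComplex.quasiIso_iff_of_zeros']
      · refine (ShortComplex.exact_and_epi_g_iff_of_iso ?_).2 (exact_aug h)
        refine ShortComplex.isoMk (Iso.refl _) (Iso.refl _) (Iso.refl _) ?_ ?_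
        · exact (Category.id_comp (d X P 0)).trans ((complex_d h.comm 0).symm.trans
            (Category.comp_id _).symm)
        · exact (Category.id_comp (aug m₀)).trans (Category.comp_id (aug m₀)).symm
      all_goals rfl
    | succ n =>
      rw [quasiIsoAt_iff_exactAt']
      · exact exactAt_succ h n
      · exact ChainComplex.exactAt_succ_single_obj _ _⟩

section Ext

variable [Algebra ℂ E]

/-- The action of the commuting pair on `M` has vanishing higher Koszul cohomology, and its joint
kernel is the line spanned by `m₀`. -/
structure IsCoacyclic (X P : E) {M : ModuleCat.{0} E} (m₀ : M) : Prop where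
  ne_zero : m₀ ≠ 0
  exists_smul : ∀ m : M, ∃ n : M, X • n = m
  exists_smul_of_smul_eq_zero : ∀ m : M, X • m = 0 → ∃ n : M, X • n = 0 ∧ P • n = m
  exists_eq_smul : ∀ m : M, X • m = 0 → P • m = 0 → ∃ c : ℂ, m = algebraMap ℂ E c • m₀

lemma isZero_ext (h : IsResolution X P m₀) (hM : IsCoacyclic X P m₀) (n : ℕ) :
    Limits.IsZero (((Ext ℂ (ModuleCat E) (n + 1)).obj (Opposite.op M)).obj M) := by
  refine Limits.IsZero.of_iso ?_ ((resolution h).isoExt (n + 1) M)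
  rw [← HomologicalComplex.exactAt_iff_isZero_homology,
    HomologicalComplex.exactAt_iff' _ n (n + 1) (n + 2) (by simp) (by simp),
    ShortComplex.moduleCat_exact_iff]
  change ∀ f : obj E (n + 1) ⟶ M, (complex h.comm).d (n + 1 + 1) (n + 1) ≫ f = 0 →
    ∃ g : obj E n ⟶ M, (complex h.comm).d (n + 1) n ≫ g = f
  rw [complex_d, complex_d]
  match n with
  | 0 =>
    intro f hf
    let f' : E × E →ₗ[E] M := f.hom
    have hf' : P • f' (1, 0) = X • f' (0, 1) := by
      have h1 : f' (dTwo X P 1) = 0 := ConcreteCategory.congr_hom hf (1 : E)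
      have h2 : dTwo X P 1 = P • (1, 0) - X • (0, 1) := by simp
      rwa [h2, map_sub, map_smul, map_smul, sub_eq_zero] at h1
    obtain ⟨m, hm⟩ := hM.exists_smul (f' (1, 0))
    obtain ⟨n, hn, hn'⟩ := hM.exists_smul_of_smul_eq_zero (f' (0, 1) - P • m) (by
      rw [smul_sub, ← mul_smul, h.comm.eq, mul_smul, hm, hf', sub_self])
    refine ⟨ModuleCat.ofHom (LinearMap.toSpanSingleton E M (m + n)), ?_⟩
    ext (a : E × E)
    change (dOne X P a) • (m + n) = f' a
    have ha : a = a.1 • (1, 0) + a.2 • (0, 1) := by simp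
    conv_rhs => rw [ha, map_add, map_smul, map_smul]
    rw [dOne_apply, add_smul, mul_smul, mul_smul, smul_add X, smul_add P, hm, hn, hn']
    simp
  | 1 =>
    intro f hf
    let f' : E →ₗ[E] M := f.hom
    obtain ⟨m, hm⟩ := hM.exists_smul (-f' 1)
    refine ⟨ModuleCat.ofHom (LinearMap.toSpanSingleton E M m ∘ₗ LinearMap.snd E E E), ?_⟩
    refine ModuleCat.hom_ext (LinearMap.ext fun (a : E) => ?_)
    change (dTwo X P a).2 • m = f' a
    rw [dTwo_apply, neg_smul, mul_smul, hm, smul_neg, neg_neg, ← map_smul, smul_eq_mul, mul_one]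
  | n + 2 =>
    intro f hf
    refine ⟨0, ?_⟩
    ext (x : PUnit)
    exact (map_zero f.hom).symm

lemma nonempty_ext_zero_iso (h : IsResolution X P m₀) (hM : IsCoacyclic X P m₀) :
    Nonempty (((Ext ℂ (ModuleCat E) 0).obj (Opposite.op M)).obj M ≅ ModuleCat.of ℂ ℂ) := by
  let K := (complex h.comm).linearYonedaObj ℂ M
  let e : (ModuleCat.of ℂ (LinearMap.ker (K.d 0 1).hom)) ≅ K.cycles 0 :=
    (ModuleCat.kernelIsLimit (K.d 0 1)).conePointUniqueUpToIso (K.cyclesIsKernel 0 1 (by simp))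
  refine ⟨(resolution h).isoExt 0 M ≪≫ K.isoHomologyπ₀.symm ≪≫ e.symm ≪≫ ?_⟩
  refine (LinearEquiv.ofBijective (LinearMap.codRestrict (LinearMap.ker (K.d 0 1).hom)
    (LinearMap.toSpanSingleton ℂ (obj E 0 ⟶ M) (aug m₀)) ?_) ⟨?_, ?_⟩).toModuleIso.symm
  · intro c
    change (complex h.comm).d 1 0 ≫ (c • aug m₀) = 0
    rw [complex_d]
    exact (Linear.comp_smul _ _ _ (d X P 0) c (aug m₀)).trans
      ((congrArg (c • ·) (d_comp_aug h)).trans (smul_zero c))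
  · refine (injective_iff_map_eq_zero _).2 fun c hc => ?_
    by_contra hc0
    have h1 : algebraMap ℂ E c • (1 : E) • m₀ = 0 :=
      ConcreteCategory.congr_hom (congrArg Subtype.val hc) (1 : E)
    apply hM.ne_zero
    rw [← one_smul E m₀, ← map_one (algebraMap ℂ E), ← inv_mul_cancel₀ hc0, map_mul, mul_smul,
      ← one_smul E m₀, h1, smul_zero]
  · rintro ⟨f, hf⟩
    replace hf : (complex h.comm).d 1 0 ≫ f = 0 := hf
    rw [complex_d] at hf
    let f' : E →ₗ[E] M := f.hom
    have key (a : E × E) : (dOne X P a) • f' 1 = 0 := by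
      rw [← map_smul, smul_eq_mul, mul_one]
      exact ConcreteCategory.congr_hom hf a
    obtain ⟨c, hc⟩ := hM.exists_eq_smul (f' 1) (by simpa using key (1, 0))
      (by simpa using key (0, 1))
    refine ⟨c, Subtype.ext ?_⟩
    change c • aug m₀ = f
    refine ModuleCat.hom_ext (LinearMap.ext fun (a : E) => ?_)
    change algebraMap ℂ E c • a • m₀ = f' a
    rw [← mul_smul, Algebra.commutes, mul_smul, ← hc, ← map_smul, smul_eq_mul, mul_one]

end Ext

end KoszulTwo

section

open Polynomial

/-- The pair `x`, `p` satisfies the Weyl relation universally and generates the algebra. -/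
structure IsWeylPair {A : Type} [Ring A] [Algebra ℂ A] (x p : A) : Prop where
  rel : x * p = p * x + 1
  adjoin_eq_top : Algebra.adjoin ℂ {x, p} = ⊤
  exists_lift : ∀ {B : Type} [Ring B] [Algebra ℂ B] (a b : B), a * b = b * a + 1 →
    ∃ f : A →ₐ[ℂ] B, f x = a ∧ f p = b

namespace IsWeylPair

variable {A : Type} [Ring A] [Algebra ℂ A] {x p : A}

section Env

/-- The element `a ⊗ 1 - 1 ⊗ a` of the enveloping algebra. -/
def diff (a : A) : env A := a ⊗ₜ 1 - 1 ⊗ₜ op a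

lemma commute_diff (h : IsWeylPair x p) : Commute (diff x) (diff p) := by
  have h1 : (op x : Aᵐᵒᵖ) * op p = op p * op x - 1 := by
    rw [← op_mul, ← op_mul, h.rel]; simp
  simp only [Commute, SemiconjBy, diff, mul_sub, sub_mul, Algebra.TensorProduct.tmul_mul_tmul,
    one_mul, mul_one, h.rel, h1, tmul_sub, add_tmul]
  abel

variable (φ : A →ₐ[ℂ] A[X][X])

/-- Constants, as an algebra map. -/
def const (A : Type) [Ring A] [Algebra ℂ A] : A →ₐ[ℂ] A[X][X] :=
  (CAlgHom (R := ℂ) (A := A[X])).comp CAlgHom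

@[simp]
lemma const_apply (a : A) : const A a = C (C a) := rfl

/-- The map `s ⊗ t ↦ s φ(t)`. -/
def toPoly : env A →ₗ[ℂ] A[X][X] :=
  TensorProduct.lift ((LinearMap.mul ℂ A[X][X]).compl₁₂ (const A).toLinearMap
    (φ.toLinearMap ∘ₗ (opLinearEquiv ℂ).symm.toLinearMap))

@[simp]
lemma toPoly_tmul (s : A) (t : Aᵐᵒᵖ) : toPoly φ (s ⊗ₜ t) = C (C s) * φ t.unop := by
  simp [toPoly]

lemma toPoly_mul_diff (a : A) (u : A[X][X]) (hu : ∀ F, Commute F u)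
    (hφ : φ a = C (C a) - u) (e : env A) : toPoly φ (e * diff a) = toPoly φ e * u := by
  induction e using TensorProduct.induction_on with
  | zero => simp
  | add y z hy hz => simp only [add_mul, map_add, hy, hz]
  | tmul s t =>
    simp only [diff, mul_sub, Algebra.TensorProduct.tmul_mul_tmul, mul_one, map_sub, toPoly_tmul,
      unop_mul, unop_op, map_mul, hφ, mul_assoc, sub_mul, ← (hu _).eq]
    abel

/-- The map `∑ a u ^ i v ^ j ↦ (a ⊗ 1) U ^ i V ^ j`. -/
def ofPoly (U V : env A) : A[X][X] →ₗ[ℂ] env A :=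
  lsum fun j => lsum fun i => LinearMap.mulRight ℂ (U ^ i * V ^ j) ∘ₗ
    Algebra.TensorProduct.includeLeft.toLinearMap

@[simp]
lemma ofPoly_monomial (U V : env A) (i j : ℕ) (a : A) :
    ofPoly U V (monomial j (monomial i a)) = (a ⊗ₜ 1) * (U ^ i * V ^ j) := by
  simp [ofPoly, sum_monomial_index, mul_assoc]

@[elab_as_elim]
lemma induction_monomial {R : Type*} [Semiring R] {motive : R[X][X] → Prop} (F : R[X][X])
    (add : ∀ F G, motive F → motive G → motive (F + G))
    (mono : ∀ i j a, motive (monomial j (monomial i a))) : motive F := by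
  induction F using Polynomial.induction_on' with
  | add F G hF hG => exact add F G hF hG
  | monomial j f =>
    induction f using Polynomial.induction_on' with
    | add f g hf hg => rw [map_add]; exact add _ _ hf hg
    | monomial i a => exact mono i j a

lemma toPoly_ofPoly {U V : env A} (hU : ∀ e, toPoly φ (e * U) = toPoly φ e * C X)
    (hV : ∀ e, toPoly φ (e * V) = toPoly φ e * X) (F : A[X][X]) :
    toPoly φ (ofPoly U V F) = F := by
  have hU' (e) (i : ℕ) : toPoly φ (e * U ^ i) = toPoly φ e * C X ^ i := by
    induction i with
    | zero => simp
    | succ i ih => rw [pow_succ, ← mul_assoc, hU, ih, pow_succ, mul_assoc]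
  have hV' (e) (i : ℕ) : toPoly φ (e * V ^ i) = toPoly φ e * X ^ i := by
    induction i with
    | zero => simp
    | succ i ih => rw [pow_succ, ← mul_assoc, hV, ih, pow_succ, mul_assoc]
  induction F using induction_monomial with
  | add F G hF hG => rw [map_add, map_add, hF, hG]
  | mono i j a =>
    rw [ofPoly_monomial, ← mul_assoc, hV', hU', toPoly_tmul]
    simp [← C_mul_X_pow_eq_monomial]

lemma ofPoly_mul_sub {a : A} {u : A[X][X]} {U V : env A}
    (hu : ∀ F, ofPoly U V (F * u) = ofPoly U V F * diff a)
    (hU : Commute (diff a) U) (hV : Commute (diff a) V) (F : A[X][X]) :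
    ofPoly U V (F * (C (C a) - u)) = (1 ⊗ₜ op a) * ofPoly U V F := by
  rw [mul_sub, map_sub, hu]
  induction F using induction_monomial with
  | add F G hF hG =>
    simp only [add_mul, mul_add, map_add, ← hF, ← hG]
    abel
  | mono i j b =>
    simp only [monomial_mul_C, ofPoly_monomial]
    have hc := ((hU.pow_right i).mul_right (hV.pow_right j)).eq
    have ha : (b * a) ⊗ₜ[ℂ] 1 = (1 ⊗ₜ[ℂ] op a) * (b ⊗ₜ[ℂ] 1) + (b ⊗ₜ[ℂ] 1) * (diff a : env A) := by
      simp [diff, mul_sub]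
    rw [mul_assoc, ← hc, ha, add_mul, mul_assoc, mul_assoc, add_sub_cancel_right]

lemma toPoly_bijective (h : IsWeylPair x p) (hx : φ x = C (C x) - C X) (hp : φ p = C (C p) - X) :
    Function.Bijective (toPoly φ) := by
  have hu (F : A[X][X]) : ofPoly (diff x) (diff p) (F * C X) =
      ofPoly (diff x) (diff p) F * diff x := by
    induction F using induction_monomial with
    | add F G hF hG => simp only [add_mul, map_add, hF, hG]
    | mono i j b =>
      simp only [monomial_mul_C, monomial_mul_X, ofPoly_monomial]
      rw [pow_succ, mul_assoc _ (diff x), (h.commute_diff.pow_right j).eq]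
      simp only [mul_assoc]
  have hv (F : A[X][X]) : ofPoly (diff x) (diff p) (F * X) =
      ofPoly (diff x) (diff p) F * diff p := by
    induction F using induction_monomial with
    | add F G hF hG => simp only [add_mul, map_add, hF, hG]
    | mono i j b => simp only [monomial_mul_X, ofPoly_monomial, pow_succ, mul_assoc]
  have key (t : A) (F : A[X][X]) : ofPoly (diff x) (diff p) (F * φ t) =
      (1 ⊗ₜ op t) * ofPoly (diff x) (diff p) F := by
    have ht : t ∈ Algebra.adjoin ℂ {x, p} := h.adjoin_eq_top ▸ Algebra.mem_top
    induction ht using Algebra.adjoin_induction generalizing F with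
    | mem t ht =>
      obtain rfl | rfl := ht
      · rw [hx, ofPoly_mul_sub hu (Commute.refl _) h.commute_diff]
      · rw [hp, ofPoly_mul_sub hv h.commute_diff.symm (Commute.refl _)]
    | algebraMap r =>
      rw [AlgHom.commutes, Algebra.algebraMap_eq_smul_one, mul_smul_comm, mul_one, map_smul,
        Algebra.algebraMap_eq_smul_one, op_smul, tmul_smul, smul_mul_assoc, op_one,
        ← Algebra.TensorProduct.one_def, one_mul]
    | add s t _ _ hs ht => rw [map_add, mul_add, map_add, hs, ht, ← add_mul, ← tmul_add]; rfl
    | mul s t _ _ hs ht =>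
      rw [map_mul φ, ← mul_assoc, ht, hs, ← mul_assoc, Algebra.TensorProduct.tmul_mul_tmul, op_mul,
        one_mul]
  refine ⟨Function.LeftInverse.injective (g := ofPoly (diff x) (diff p)) fun e => ?_,
    Function.RightInverse.surjective (g := ofPoly (diff x) (diff p)) (toPoly_ofPoly φ
      (toPoly_mul_diff φ x _ (fun F => ?_) hx) (toPoly_mul_diff φ p _ (fun F => ?_) hp))⟩
  · induction e using TensorProduct.induction_on with
    | zero => simp
    | add y z hy hz => rw [map_add, map_add, hy, hz]
    | tmul s t =>
      rw [toPoly_tmul, key, ← monomial_zero_left, ← monomial_zero_left, ofPoly_monomial]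
      simp
  · ext1 n; simp [X_mul]
  · exact commute_X F |>.symm

lemma exists_of_mul_add_mul_eq_zero {R : Type*} [Ring R] (F G : R[X][X]) (h : F * C X + G * X = 0) :
    ∃ H, F = H * X ∧ G = -(H * C X) := by
  have hF : F.coeff 0 = 0 := by
    have := congrArg (coeff · 0) h
    ext n
    simpa using congrArg (coeff · (n + 1)) this
  have hF' : F = F.divX * X := by
    conv_lhs => rw [← divX_mul_X_add F, hF]
    simp
  refine ⟨F.divX, hF', ?_⟩
  have key : (G + F.divX * C X) * X = 0 := by
    conv_lhs at h => rw [hF']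
    rw [add_mul, mul_assoc, ← X_mul (p := C X), ← mul_assoc, add_comm, h]
  rw [eq_neg_iff_add_eq_zero]
  ext1 n
  simpa using congrArg (coeff · (n + 1)) key

lemma exists_of_coeff_zero {R : Type*} [Ring R] (F : R[X][X]) (h : (F.coeff 0).coeff 0 = 0) :
    ∃ G H, F = G * C X + H * X := by
  refine ⟨C (F.coeff 0).divX, F.divX, ?_⟩
  conv_lhs => rw [← divX_mul_X_add F, ← divX_mul_X_add (F.coeff 0), h]
  simp [add_comm]

end Env

attribute [local instance] TensorProduct.Algebra.module

lemma diff_smul (a m : A) : diff a • m = a * m - m * a := by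
  simp [diff, sub_smul, TensorProduct.Algebra.smul_def]

lemma toPoly_coeff_zero (h : IsWeylPair x p) {φ : A →ₐ[ℂ] A[X][X]} (hx : φ x = C (C x) - C X)
    (hp : φ p = C (C p) - X) (e : env A) : ((toPoly φ e).coeff 0).coeff 0 = e • (1 : A) := by
  have key (t : A) : ((φ t).coeff 0).coeff 0 = t := by
    have ht : t ∈ Algebra.adjoin ℂ {x, p} := h.adjoin_eq_top ▸ Algebra.mem_top
    induction ht using Algebra.adjoin_induction with
    | mem t ht =>
      obtain rfl | rfl := ht
      · simp [hx]
      · simp [hp]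
    | algebraMap r => simp [Polynomial.algebraMap_apply]
    | add s t _ _ hs ht => simp [hs, ht]
    | mul s t _ _ hs ht => simp [mul_coeff_zero, hs, ht]
  induction e using TensorProduct.induction_on with
  | zero => exact (zero_smul (env A) (1 : A)).symm
  | add y z hy hz => simp [add_smul, hy, hz]
  | tmul s t => simp [key, TensorProduct.Algebra.smul_def]

section Basis

lemma exists_derivative_eq {R : Type*} [CommRing R] [Algebra ℂ R] (f : R[X]) :
    ∃ g, derivative g = f := by
  induction f using Polynomial.induction_on' with
  | add f g hf hg =>
    obtain ⟨⟨f, rfl⟩, ⟨g, rfl⟩⟩ := hf, hg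
    exact ⟨f + g, derivative_add⟩
  | monomial n a =>
    refine ⟨monomial (n + 1) (((n : ℂ) + 1)⁻¹ • a), ?_⟩
    have : (n : ℂ) + 1 ≠ 0 := by exact_mod_cast n.succ_ne_zero
    rw [derivative_monomial, Nat.add_sub_cancel]
    congr 1
    rw [mul_comm, ← nsmul_eq_mul, ← Nat.cast_smul_eq_nsmul ℂ, smul_smul]
    push_cast
    rw [mul_inv_cancel₀ this, one_smul]

lemma mul_pow_eq {R : Type*} [Ring R] {a b : R} (h : a * b = b * a + 1) (n : ℕ) :
    a * b ^ n = b ^ n * a + n * b ^ (n - 1) := by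
  induction n with
  | zero => simp
  | succ n ih =>
    rw [pow_succ', ← mul_assoc, h, add_mul, mul_assoc, ih]
    cases n with
    | zero => simp
    | succ n =>
      simp only [Nat.add_sub_cancel, mul_add, ← mul_assoc, ← pow_succ', one_mul]
      rw [← (Nat.cast_commute (n + 1) b).eq, mul_assoc, ← pow_succ']
      push_cast
      noncomm_ring

lemma pow_mul_eq {R : Type*} [Ring R] {a b : R} (h : a * b = b * a + 1) (n : ℕ) :
    a ^ n * b = b * a ^ n + n * a ^ (n - 1) := by
  have := mul_pow_eq (a := -b) (b := a) (by rw [mul_neg, h]; noncomm_ring) n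
  rw [mul_neg, neg_mul, neg_eq_iff_eq_neg] at this
  rw [this]
  abel

/-- The map `∑ g_j(x) y ^ j ↦ ∑ p ^ j g_j(x)` from bivariate polynomials. -/
def ofBivariate (x p : A) : ℂ[X][X] →ₗ[ℂ] A :=
  lsum fun j => LinearMap.mulLeft ℂ (p ^ j) ∘ₗ (aeval x).toLinearMap

@[simp]
lemma ofBivariate_monomial (j i : ℕ) (c : ℂ) :
    ofBivariate x p (monomial j (monomial i c)) = c • (p ^ j * x ^ i) := by
  simp [ofBivariate, sum_monomial_index, aeval_monomial, Algebra.algebraMap_eq_smul_one]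

lemma ofBivariate_C (g : ℂ[X]) : ofBivariate x p (C g) = aeval x g := by
  simp [ofBivariate]

lemma ofBivariate_mul_C_X (F : ℂ[X][X]) :
    ofBivariate x p (F * C X) = ofBivariate x p F * x := by
  induction F using induction_monomial with
  | add F G hF hG => simp only [add_mul, map_add, hF, hG]
  | mono i j b => simp [monomial_mul_C, monomial_mul_X, pow_succ, mul_assoc]

lemma ofBivariate_mul_X (F : ℂ[X][X]) :
    ofBivariate x p (F * X) = p * ofBivariate x p F := by
  induction F using induction_monomial with
  | add F G hF hG => simp only [add_mul, mul_add, map_add, hF, hG]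
  | mono i j b => simp [monomial_mul_X, pow_succ', mul_assoc]

lemma ofBivariate_derivative (h : x * p = p * x + 1) (F : ℂ[X][X]) :
    ofBivariate x p (derivative F) = x * ofBivariate x p F - ofBivariate x p F * x := by
  induction F using induction_monomial with
  | add F G hF hG =>
    simp only [add_mul, mul_add, map_add, hF, hG]
    abel
  | mono i j b =>
    have : (monomial i b * (j : ℂ[X])) = monomial i (b * j) := by
      rw [← C_eq_natCast, monomial_mul_C]
    rw [derivative_monomial, this, ofBivariate_monomial, ofBivariate_monomial, mul_smul_comm,
      smul_mul_assoc, ← mul_assoc, mul_pow_eq h, ← smul_sub, mul_smul, add_mul, mul_assoc, mul_assoc,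
      mul_assoc, ← pow_succ, ← pow_succ', add_sub_cancel_left, Nat.cast_smul_eq_nsmul, nsmul_eq_mul]

lemma ofBivariate_C_derivative (h : x * p = p * x + 1) (g : ℂ[X]) :
    ofBivariate x p (C (derivative g)) =
      ofBivariate x p (C g) * p - p * ofBivariate x p (C g) := by
  simp only [ofBivariate_C]
  induction g using Polynomial.induction_on' with
  | add F G hF hG =>
    simp only [add_mul, mul_add, map_add, hF, hG]
    abel
  | monomial i c =>
    rw [derivative_monomial]
    simp only [aeval_monomial, Algebra.algebraMap_eq_smul_one, smul_mul_assoc, mul_smul_comm,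
      one_mul, pow_mul_eq h, ← smul_sub, add_sub_cancel_left]
    rw [mul_smul, Nat.cast_smul_eq_nsmul, nsmul_eq_mul]

lemma ofBivariate_bijective (h : IsWeylPair x p) : Function.Bijective (ofBivariate x p) := by
  obtain ⟨ρ, hρx, hρp⟩ := h.exists_lift (B := Module.End ℂ ℂ[X][X])
    (LinearMap.mulRight ℂ (C X) + derivative.restrictScalars ℂ) (LinearMap.mulRight ℂ X) (by
      ext1 F
      simp
      ring)
  have key (a : A) (F : ℂ[X][X]) : ofBivariate x p (ρ a F) = a * ofBivariate x p F := by
    have ha : a ∈ Algebra.adjoin ℂ {x, p} := h.adjoin_eq_top ▸ Algebra.mem_top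
    induction ha using Algebra.adjoin_induction generalizing F with
    | mem t ht =>
      obtain rfl | rfl := ht
      · simp [hρx, ofBivariate_mul_C_X, ofBivariate_derivative h.rel]
      · simp [hρp, ofBivariate_mul_X]
    | algebraMap r => simp [Algebra.algebraMap_eq_smul_one]
    | add s t _ _ hs ht => simp [hs, ht, add_mul]
    | mul s t _ _ hs ht => simp [hs, ht, mul_assoc]
  constructor
  · refine Function.LeftInverse.injective (g := fun a => ρ a 1) fun F => ?_
    induction F using induction_monomial with
    | add F G hF hG => simp only [map_add, LinearMap.add_apply, hF, hG]
    | mono i j c =>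
      have hx (i : ℕ) : (ρ x ^ i) 1 = C (X ^ i) := by
        induction i with
        | zero => simp
        | succ i ih => rw [pow_succ', Module.End.mul_apply, ih, hρx]; simp [pow_succ]
      have hp (j : ℕ) (F : ℂ[X][X]) : (ρ p ^ j) F = F * X ^ j := by
        induction j with
        | zero => simp
        | succ j ih => rw [pow_succ', Module.End.mul_apply, ih, hρp]; simp [pow_succ, mul_assoc]
      simp only [ofBivariate_monomial, map_smul, map_mul, map_pow, LinearMap.smul_apply,
        Module.End.mul_apply, hx, hp]
      simp [← C_mul_X_pow_eq_monomial, Algebra.smul_def, Polynomial.algebraMap_apply, mul_assoc]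
  · exact fun a => ⟨ρ a 1, by rw [key, ← C_1, ofBivariate_C, map_one, mul_one]⟩

lemma exists_mul_sub_mul_eq (h : IsWeylPair x p) (m : A) : ∃ n, x * n - n * x = m := by
  obtain ⟨F, rfl⟩ := h.ofBivariate_bijective.2 m
  obtain ⟨G, rfl⟩ := exists_derivative_eq F
  exact ⟨_, (ofBivariate_derivative h.rel G).symm⟩

lemma exists_aeval_eq (h : IsWeylPair x p) {m : A} (hm : x * m - m * x = 0) :
    ∃ g : ℂ[X], ofBivariate x p (C g) = m := by
  obtain ⟨F, rfl⟩ := h.ofBivariate_bijective.2 m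
  rw [← ofBivariate_derivative h.rel, map_eq_zero_iff _ h.ofBivariate_bijective.1] at hm
  exact ⟨F.coeff 0,
    by rw [← eq_C_of_natDegree_eq_zero (derivative_eq_zero.1 hm)]⟩

lemma exists_commuting_mul_sub_mul_eq (h : IsWeylPair x p) {m : A} (hm : x * m - m * x = 0) :
    ∃ n, x * n - n * x = 0 ∧ p * n - n * p = m := by
  obtain ⟨f, rfl⟩ := h.exists_aeval_eq hm
  obtain ⟨g, rfl⟩ := exists_derivative_eq f
  refine ⟨ofBivariate x p (C (-g)), ?_, ?_⟩
  · rw [← ofBivariate_derivative h.rel, derivative_C, map_zero]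
  · rw [← neg_sub, ← ofBivariate_C_derivative h.rel, derivative_neg, C_neg, map_neg, neg_neg]

lemma exists_smul_one_eq (h : IsWeylPair x p) {m : A} (hx : x * m - m * x = 0)
    (hp : p * m - m * p = 0) : ∃ c : ℂ, m = c • 1 := by
  obtain ⟨f, rfl⟩ := h.exists_aeval_eq hx
  rw [← neg_sub, neg_eq_zero, ← ofBivariate_C_derivative h.rel,
    map_eq_zero_iff _ h.ofBivariate_bijective.1, C_eq_zero] at hp
  refine ⟨f.coeff 0, ?_⟩
  rw [eq_C_of_natDegree_eq_zero (derivative_eq_zero.1 hp), ofBivariate_C]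
  simp [Algebra.algebraMap_eq_smul_one]

lemma nontrivial (h : IsWeylPair x p) : Nontrivial A :=
  (h.ofBivariate_bijective.1).nontrivial

end Basis

lemma isResolution (h : IsWeylPair x p) :
    KoszulTwo.IsResolution (M := envBimod A) (diff x) (diff p) (1 : A) := by
  obtain ⟨φ, hx, hp⟩ := h.exists_lift (B := A[X][X]) (C (C x) - C X) (C (C p) - X) (by
    have hX : (C X : A[X][X]) * C (C p) = C (C p) * C X := by rw [← C_mul, ← C_mul, X_mul]
    have hX' : (X : A[X][X]) * C (C x) = C (C x) * X := X_mul
    have hX'' : (X : A[X][X]) * C X = C X * X := X_mul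
    have hr : (C (C x) : A[X][X]) * C (C p) = C (C p) * C (C x) + 1 := by
      rw [← C_mul, ← C_mul, h.rel]
      simp
    simp only [sub_mul, mul_sub, hX, hX', hX'', hr]
    abel)
  have hbij := h.toPoly_bijective φ hx hp
  have hcomm (F : A[X][X]) : Commute F (C X) := by
    ext1 n
    simp [X_mul]
  have hx' := toPoly_mul_diff φ x _ hcomm hx
  have hp' := toPoly_mul_diff φ p _ (fun F => (commute_X F).symm) hp
  refine ⟨h.commute_diff, fun e he => ?_, fun a b hab => ?_, ?_, ?_, fun e he => ?_, fun m => ?_⟩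
  · apply hbij.1
    have := congrArg (toPoly φ) he
    rw [hp', map_zero] at this
    rw [map_zero]
    ext1 n
    simpa using congrArg (coeff · (n + 1)) this
  · have := congrArg (toPoly φ) hab
    rw [map_add, hx', hp', map_zero] at this
    obtain ⟨H, h₁, h₂⟩ := exists_of_mul_add_mul_eq_zero _ _ this
    obtain ⟨e, rfl⟩ := hbij.2 H
    exact ⟨e, hbij.1 (by rw [h₁, hp']), hbij.1 (by rw [h₂, map_neg, hx'])⟩
  · exact (diff_smul x 1).trans (by simp)
  · exact (diff_smul p 1).trans (by simp)
  · obtain ⟨G, H, hF⟩ := exists_of_coeff_zero (toPoly φ e)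
      ((h.toPoly_coeff_zero hx hp e).trans he)
    obtain ⟨a, rfl⟩ := hbij.2 G
    obtain ⟨b, rfl⟩ := hbij.2 H
    exact ⟨a, b, hbij.1 (by rw [hF, map_add, hx', hp'])⟩
  · exact ⟨m ⊗ₜ 1, (TensorProduct.Algebra.smul_def m (1 : Aᵐᵒᵖ) (1 : A)).trans (by simp)⟩

lemma isCoacyclic (h : IsWeylPair x p) :
    KoszulTwo.IsCoacyclic (M := envBimod A) (diff x) (diff p) (1 : A) := by
  have := h.nontrivial
  refine ⟨one_ne_zero (α := A), fun m => ?_, fun m hm => ?_, fun m hx hp => ?_⟩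
  · obtain ⟨n, hn⟩ := h.exists_mul_sub_mul_eq m
    exact ⟨n, (diff_smul x n).trans hn⟩
  · obtain ⟨n, hn, hn'⟩ := h.exists_commuting_mul_sub_mul_eq ((diff_smul x m).symm.trans hm)
    exact ⟨n, (diff_smul x n).trans hn, (diff_smul p n).trans hn'⟩
  · obtain ⟨c, hc⟩ := h.exists_smul_one_eq ((diff_smul x m).symm.trans hx)
      ((diff_smul p m).symm.trans hp)
    refine ⟨c, hc.trans ?_⟩
    refine Eq.trans ?_ (TensorProduct.Algebra.smul_def (algebraMap ℂ A c) (1 : Aᵐᵒᵖ) (1 : A)).symm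
    simp [Algebra.algebraMap_eq_smul_one]

end IsWeylPair

lemma Weyl.isWeylPair : IsWeylPair Weyl.x Weyl.p where
  rel := by
    have := RingQuot.mkAlgHom_rel ℂ weylRel.rel
    simp only [map_mul, map_add, map_one] at this
    exact this
  adjoin_eq_top := by
    have := congrArg (Subalgebra.map (RingQuot.mkAlgHom ℂ weylRel))
      (FreeAlgebra.adjoin_range_ι ℂ (Fin 2))
    rw [AlgHom.map_adjoin, Algebra.map_top,
      (AlgHom.range_eq_top _).2 (RingQuot.mkAlgHom_surjective ℂ weylRel), ← Set.range_comp] at this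
    rw [← this]
    congr 1
    ext a
    simp [Fin.exists_fin_two, Weyl.x, Weyl.p, eq_comm]
  exists_lift {B} _ _ a b hab := by
    refine ⟨RingQuot.liftAlgHom ℂ ⟨FreeAlgebra.lift ℂ ![a, b], ?_⟩, ?_, ?_⟩
    · rintro _ _ ⟨⟩
      simpa using hab
    · simp [Weyl.x]
    · simp [Weyl.p]

end

/-- The Hochschild cohomology of the Weyl algebra `𝒜` satisfies
`HH^0(𝒜) ≅ ℂ` and `HH^i(𝒜) = 0` for `i ≠ 0`. -/
theorem statement13 :
    Nonempty (HHcoh Weyl 0 ≅ ModuleCat.of ℂ ℂ) ∧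
    ∀ i : ℕ, i ≠ 0 → Limits.IsZero (HHcoh Weyl i) := by
  refine ⟨KoszulTwo.nonempty_ext_zero_iso Weyl.isWeylPair.isResolution Weyl.isWeylPair.isCoacyclic,
    fun i hi => ?_⟩
  obtain ⟨n, rfl⟩ := Nat.exists_eq_succ_of_ne_zero hi
  exact KoszulTwo.isZero_ext Weyl.isWeylPair.isResolution Weyl.isWeylPair.isCoacyclic n
end
end

section
/- Let 𝔸 be the trigonometric Weyl algebra. Then the Hochschild cohomology of 𝔸 satisfies: HH^0(𝔸) ≅ ℂ, HH^1(𝔸) ≅ ℂ, and HH^i(𝔸) = 0 for all i ≠ 0, 1. -/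
open TensorProduct CategoryTheory MulOpposite

noncomputable section

/-- The defining relations of the trigonometric Weyl algebra
(generators: `0 ↦ X`, `1 ↦ X⁻¹`, `2 ↦ p`): `X X⁻¹ = 1`, `X⁻¹ X = 1`, `X p = p X + X`. -/
inductive trigWeylRel : FreeAlgebra ℂ (Fin 3) → FreeAlgebra ℂ (Fin 3) → Prop
  | relXXinv : trigWeylRel (FreeAlgebra.ι ℂ 0 * FreeAlgebra.ι ℂ 1) 1
  | relXinvX : trigWeylRel (FreeAlgebra.ι ℂ 1 * FreeAlgebra.ι ℂ 0) 1
  | relXp : trigWeylRel (FreeAlgebra.ι ℂ 0 * FreeAlgebra.ι ℂ 2)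
      (FreeAlgebra.ι ℂ 2 * FreeAlgebra.ι ℂ 0 + FreeAlgebra.ι ℂ 0)

/-- The trigonometric Weyl algebra `𝔸`. -/
abbrev TrigWeyl : Type := RingQuot trigWeylRel

/-- The generator `X` of the trigonometric Weyl algebra. -/
def TrigWeyl.X : TrigWeyl := RingQuot.mkAlgHom ℂ trigWeylRel (FreeAlgebra.ι ℂ 0)

/-- The generator `X⁻¹` of the trigonometric Weyl algebra. -/
def TrigWeyl.Xinv : TrigWeyl := RingQuot.mkAlgHom ℂ trigWeylRel (FreeAlgebra.ι ℂ 1)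

/-- The generator `p` of the trigonometric Weyl algebra. -/
def TrigWeyl.p : TrigWeyl := RingQuot.mkAlgHom ℂ trigWeylRel (FreeAlgebra.ι ℂ 2)


namespace Koszul

variable {R : Type} [Ring R]

/-- The objects of the Koszul complex of two commuting elements. -/
def obj (R : Type) [Ring R] : ℕ → ModuleCat R
  | 0 => ModuleCat.of R R
  | 1 => ModuleCat.of R (R × R)
  | 2 => ModuleCat.of R R
  | _ + 3 => ModuleCat.of R PUnit

/-- The differential `(x, y) ↦ x * s + y * w`. -/
def d₁ (s w : R) : R × R →ₗ[R] R :=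
  (LinearMap.toSpanSingleton R R s).coprod (LinearMap.toSpanSingleton R R w)

/-- The differential `x ↦ (x * w, - (x * s))`. -/
def d₂ (s w : R) : R →ₗ[R] R × R :=
  (LinearMap.toSpanSingleton R R w).prod (-LinearMap.toSpanSingleton R R s)

@[simp] lemma d₁_apply (s w : R) (x : R × R) : d₁ s w x = x.1 * s + x.2 * w := by
  simp [d₁]

@[simp] lemma d₂_apply (s w x : R) : d₂ s w x = (x * w, -(x * s)) := by
  simp [d₂]

/-- The differentials of the Koszul complex of two commuting elements. -/
def diff (s w : R) : ∀ i j : ℕ, obj R i ⟶ obj R j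
  | 1, 0 => ModuleCat.ofHom (d₁ s w)
  | 2, 1 => ModuleCat.ofHom (d₂ s w)
  | _, _ => 0

/-- The Koszul complex, by right multiplication, of two commuting elements of a ring. -/
def complex (s w : R) (comm : s * w = w * s) : ChainComplex (ModuleCat R) ℕ where
  X := obj R
  d := diff s w
  shape i j h := by
    match i, j with
    | 1, 0 => simp at h
    | 2, 1 => simp at h
    | 0, _ => rfl
    | 1, _ + 1 => rfl
    | 2, 0 => rfl
    | 2, _ + 2 => rfl
    | _ + 3, _ => rfl
  d_comp_d' i j k hij hjk := by
    obtain rfl : j + 1 = i := hij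
    obtain rfl : k + 1 = j := hjk
    match k with
    | 0 =>
      have h : d₁ s w ∘ₗ d₂ s w = 0 := LinearMap.ext fun x => by simp [mul_assoc, comm]
      exact ModuleCat.hom_ext h
    | _ + 1 => exact Limits.zero_comp

variable {M : Type} [AddCommGroup M] [Module R M]

/-- The projective resolution of a quotient of `R` by a regular pair of commuting elements. -/
def resolution {s w : R} (comm : s * w = w * s) (π : R →ₗ[R] M) (hπ : Function.Surjective π)
    (hs : π s = 0) (hw : π w = 0) (hker : ∀ x, π x = 0 → ∃ y z, y * s + z * w = x)
    (hreg₁ : ∀ x, x * s = 0 → x = 0) (hreg₂ : ∀ x y, x * w = y * s → ∃ z, x = z * s) :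
    ProjectiveResolution (ModuleCat.of R M) where
  complex := complex s w comm
  projective n := by
    match n with
    | 0 => exact inferInstanceAs (Projective (ModuleCat.of R R))
    | 1 => exact inferInstanceAs (Projective (ModuleCat.of R (R × R)))
    | 2 => exact inferInstanceAs (Projective (ModuleCat.of R R))
    | _ + 3 => exact inferInstanceAs (Projective (ModuleCat.of R PUnit))
  π := (ChainComplex.toSingle₀Equiv _ _).symm ⟨ModuleCat.ofHom π, by
    refine ModuleCat.hom_ext (LinearMap.ext fun x => ?_)
    refine (congrArg π (d₁_apply s w x)).trans ?_
    rw [map_add, ← smul_eq_mul, ← smul_eq_mul, map_smul, map_smul, hs, hw, smul_zero, smul_zero,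
      add_zero]
    rfl⟩
  quasiIso := ⟨fun n => by
    match n with
    | 0 =>
      rw [ChainComplex.quasiIsoAt₀_iff, ShortComplex.quasiIso_iff_of_zeros' _ rfl rfl rfl]
      constructor
      · rw [ShortComplex.moduleCat_exact_iff]
        intro (x : R) hx
        replace hx : π x = 0 := by
          simpa only [ChainComplex.toSingle₀Equiv_symm_apply_f_zero] using! hx
        obtain ⟨y, z, rfl⟩ := hker x hx
        exact ⟨((y, z) : R × R), d₁_apply s w (y, z)⟩
      · rw [ModuleCat.epi_iff_surjective]
        simpa only [ChainComplex.toSingle₀Equiv_symm_apply_f_zero] using! hπ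
    | 1 =>
      rw [quasiIsoAt_iff_exactAt' (hL := ChainComplex.exactAt_succ_single_obj ..),
        HomologicalComplex.exactAt_iff' _ 2 1 0 (by simp) (by simp),
        ShortComplex.moduleCat_exact_iff]
      rintro ⟨x, y⟩ hxy
      replace hxy : d₁ s w (x, y) = 0 := hxy
      rw [d₁_apply] at hxy
      obtain ⟨z, rfl⟩ := hreg₂ y (-x) (by rw [neg_mul]; exact eq_neg_of_add_eq_zero_right hxy)
      have hx := hreg₁ (x + z * w) (by rw [← hxy, add_mul, mul_assoc, mul_assoc, comm])
      refine ⟨(-z : R), (d₂_apply s w (-z)).trans ?_⟩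
      simp [eq_neg_of_add_eq_zero_left hx]
    | 2 =>
      rw [quasiIsoAt_iff_exactAt' (hL := ChainComplex.exactAt_succ_single_obj ..),
        HomologicalComplex.exactAt_iff' _ 3 2 1 (by simp) (by simp),
        ShortComplex.moduleCat_exact_iff]
      intro (x : R) hx
      replace hx : d₂ s w x = 0 := hx
      rw [d₂_apply] at hx
      exact ⟨0, (map_zero _).trans (hreg₁ x (by simpa using congrArg Prod.snd hx)).symm⟩
    | n + 3 =>
      rw [quasiIsoAt_iff_exactAt' (hL := ChainComplex.exactAt_succ_single_obj ..),
        HomologicalComplex.exactAt_iff]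
      exact ShortComplex.exact_of_isZero_X₂ _
        (ModuleCat.isZero_of_subsingleton (ModuleCat.of R PUnit))⟩

lemma nonempty_homology_iso {S : ShortComplex (ModuleCat ℂ)} (φ : S.X₂ →ₗ[ℂ] ℂ)
    (hf : ∀ x, φ (S.f.hom x) = 0) (hg : ∀ y, S.g.hom y = 0 → φ y = 0 → ∃ x, S.f.hom x = y)
    (h1 : ∃ y, S.g.hom y = 0 ∧ φ y = 1) :
    Nonempty (S.homology ≅ ModuleCat.of ℂ ℂ) := by
  let ψ : LinearMap.ker S.g.hom →ₗ[ℂ] ℂ := φ ∘ₗ Submodule.subtype _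
  have hψ : LinearMap.range S.moduleCatToCycles = LinearMap.ker ψ := by
    ext ⟨y, hy⟩
    constructor
    · rintro ⟨x, hx⟩
      obtain rfl : S.f.hom x = y := congrArg Subtype.val hx
      exact hf x
    · intro h
      obtain ⟨x, hx⟩ := hg y hy h
      exact ⟨x, Subtype.ext hx⟩
  have hsurj : Function.Surjective ψ := by
    obtain ⟨y, hy, hy1⟩ := h1
    intro c
    refine ⟨c • ⟨y, hy⟩, ?_⟩
    change φ (c • y) = c
    simp [hy1]
  exact ⟨S.moduleCatHomologyIso ≪≫ (LinearEquiv.toModuleIso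
    ((Submodule.quotEquivOfEq _ _ hψ).trans (ψ.quotKerEquivOfSurjective hsurj)))⟩

section Ext

variable [Algebra ℂ R] {N : Type} [AddCommGroup N] [Module R N]

/-- Evaluation of a morphism of modules at an element, composed with a linear functional. -/
def evalFunctional {P : ModuleCat R} (x : P) (l : N →+ ℂ)
    (hl : ∀ (c : ℂ) (n : N), l (algebraMap ℂ R c • n) = c * l n) :
    (P ⟶ ModuleCat.of R N) →ₗ[ℂ] ℂ where
  toFun f := l (f.hom x)
  map_add' f g := by simp
  map_smul' c f := hl c (f.hom x)

variable {s w : R} (comm : s * w = w * s)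

/-- The cochain complex of maps from the Koszul complex to a module. -/
abbrev cochains (N : Type) [AddCommGroup N] [Module R N] : CochainComplex (ModuleCat ℂ) ℕ :=
  (complex s w comm).linearYonedaObj ℂ (ModuleCat.of R N)

lemma nonempty_homology_zero_iso (l : N →+ ℂ)
    (hl : ∀ (c : ℂ) (n : N), l (algebraMap ℂ R c • n) = c * l n)
    (hinj : ∀ n : N, s • n = 0 → w • n = 0 → l n = 0 → n = 0)
    (hone : ∃ n : N, s • n = 0 ∧ w • n = 0 ∧ l n = 1) :
    Nonempty ((cochains comm N).homology 0 ≅ ModuleCat.of ℂ ℂ) := by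
  suffices Nonempty (((cochains comm N).sc' 0 0 1).homology ≅ ModuleCat.of ℂ ℂ) from
    this.map fun e => ShortComplex.homologyMapIso
      ((cochains comm N).isoSc' 0 0 1 (by simp) (by simp)) ≪≫ e
  refine nonempty_homology_iso (evalFunctional (P := ModuleCat.of R R) (1 : R) l hl) ?_ ?_ ?_
  · intro (f : ModuleCat.of R R ⟶ ModuleCat.of R N)
    exact (congrArg l (map_zero f.hom)).trans (map_zero l)
  · intro (f : ModuleCat.of R R ⟶ ModuleCat.of R N) hf hlf
    have hf' : ∀ x : R × R, f.hom (x.1 * s + x.2 * w) = 0 := fun x => by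
      rw [← d₁_apply]
      exact congr($(hf).hom x)
    refine ⟨0, ModuleCat.hom_ext (LinearMap.ext_ring ?_)⟩
    refine (hinj _ ?_ ?_ hlf).symm
    · simpa [← map_smul] using hf' (1, 0)
    · simpa [← map_smul] using hf' (0, 1)
  · obtain ⟨n, hs, hw, hn⟩ := hone
    refine ⟨ModuleCat.ofHom (LinearMap.toSpanSingleton R N n), ?_, ?_⟩
    · refine ModuleCat.hom_ext (LinearMap.ext fun (x : R × R) => ?_)
      refine (congrArg (LinearMap.toSpanSingleton R N n) (d₁_apply s w x)).trans ?_
      simp only [LinearMap.toSpanSingleton_apply, add_smul, mul_smul, hs, hw, smul_zero, add_zero]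
      rfl
    · refine Eq.trans ?_ hn
      exact congrArg l (one_smul R n)

lemma nonempty_homology_one_iso (l : N →+ ℂ)
    (hl : ∀ (c : ℂ) (n : N), l (algebraMap ℂ R c • n) = c * l n)
    (hzero : ∀ n : N, l (w • n) = 0)
    (hinj : ∀ a b : N, w • a = s • b → l b = 0 → ∃ n : N, s • n = a ∧ w • n = b)
    (hone : ∃ a b : N, w • a = s • b ∧ l b = 1) :
    Nonempty ((cochains comm N).homology 1 ≅ ModuleCat.of ℂ ℂ) := by
  suffices Nonempty (((cochains comm N).sc' 0 1 2).homology ≅ ModuleCat.of ℂ ℂ) from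
    this.map fun e => ShortComplex.homologyMapIso
      ((cochains comm N).isoSc' 0 1 2 (by simp) (by simp)) ≪≫ e
  refine nonempty_homology_iso
    (evalFunctional (P := ModuleCat.of R (R × R)) ((0, 1) : R × R) l hl) ?_ ?_ ?_
  · intro (f : ModuleCat.of R R ⟶ ModuleCat.of R N)
    refine Eq.trans ?_ (hzero (f.hom (1 : R)))
    refine congrArg l ((congrArg f.hom (d₁_apply s w (0, 1))).trans ?_)
    simp [← map_smul]
  · intro (f : ModuleCat.of R (R × R) ⟶ ModuleCat.of R N) hf hlf
    have hf' : f.hom ((1 * w, -(1 * s)) : R × R) = 0 := by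
      rw [← d₂_apply]
      exact congr($(hf).hom (1 : R))
    obtain ⟨n, hn₁, hn₂⟩ := hinj (f.hom ((1, 0) : R × R)) (f.hom ((0, 1) : R × R)) (by
      rw [← sub_eq_zero, ← map_smul, ← map_smul, ← map_sub, ← hf']
      simp) hlf
    refine ⟨ModuleCat.ofHom (LinearMap.toSpanSingleton R N n), ModuleCat.hom_ext ?_⟩
    refine LinearMap.prod_ext (LinearMap.ext_ring ?_) (LinearMap.ext_ring ?_)
    · refine (congrArg (LinearMap.toSpanSingleton R N n) (d₁_apply s w (1, 0))).trans ?_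
      exact (LinearMap.toSpanSingleton_apply R N n _).trans (by simpa using! hn₁)
    · refine (congrArg (LinearMap.toSpanSingleton R N n) (d₁_apply s w (0, 1))).trans ?_
      exact (LinearMap.toSpanSingleton_apply R N n _).trans (by simpa using! hn₂)
  · obtain ⟨a, b, hab, hb⟩ := hone
    refine ⟨ModuleCat.ofHom ((LinearMap.toSpanSingleton R N a).coprod
      (LinearMap.toSpanSingleton R N b)), ?_, ?_⟩
    · refine ModuleCat.hom_ext (LinearMap.ext_ring ?_)
      refine (congrArg ((LinearMap.toSpanSingleton R N a).coprod
        (LinearMap.toSpanSingleton R N b)) (d₂_apply s w 1)).trans ?_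
      simp only [LinearMap.coprod_apply, LinearMap.toSpanSingleton_apply, one_mul, neg_smul, hab,
        add_neg_cancel]
      rfl
    · refine Eq.trans (congrArg l ?_) hb
      refine (LinearMap.coprod_apply _ _ _).trans ?_
      simp

lemma isZero_homology_two (hsurj : ∀ n : N, ∃ a b : N, w • a - s • b = n) :
    Limits.IsZero ((cochains comm N).homology 2) := by
  rw [← HomologicalComplex.exactAt_iff_isZero_homology,
    HomologicalComplex.exactAt_iff' _ 1 2 3 (by simp) (by simp), ShortComplex.moduleCat_exact_iff]
  intro (f : ModuleCat.of R R ⟶ ModuleCat.of R N) _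
  obtain ⟨a, b, hab⟩ := hsurj (f.hom (1 : R))
  refine ⟨ModuleCat.ofHom ((LinearMap.toSpanSingleton R N a).coprod
    (LinearMap.toSpanSingleton R N b)), ModuleCat.hom_ext (LinearMap.ext_ring ?_)⟩
  refine (congrArg ((LinearMap.toSpanSingleton R N a).coprod
    (LinearMap.toSpanSingleton R N b)) (d₂_apply s w 1)).trans ?_
  simpa [sub_eq_add_neg] using! hab

lemma isZero_homology_add_three (i : ℕ) :
    Limits.IsZero ((cochains comm N).homology (i + 3)) := by
  rw [← HomologicalComplex.exactAt_iff_isZero_homology, HomologicalComplex.exactAt_iff]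
  refine ShortComplex.exact_of_isZero_X₂ _ ?_
  have : Subsingleton (ModuleCat.of R PUnit ⟶ ModuleCat.of R N) :=
    ⟨(ModuleCat.isZero_of_subsingleton (ModuleCat.of R PUnit)).eq_of_src⟩
  exact ModuleCat.isZero_of_subsingleton
    (ModuleCat.of ℂ (ModuleCat.of R PUnit ⟶ ModuleCat.of R N))

end Ext

end Koszul

namespace TrigWeyl

open Polynomial (C taylor aeval)

lemma X_mul_Xinv : X * Xinv = 1 := by
  simpa [X, Xinv] using RingQuot.mkAlgHom_rel ℂ trigWeylRel.relXXinv

lemma Xinv_mul_X : Xinv * X = 1 := by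
  simpa [X, Xinv] using RingQuot.mkAlgHom_rel ℂ trigWeylRel.relXinvX

lemma X_mul_p : X * p = p * X + X := by
  simpa [X, p] using RingQuot.mkAlgHom_rel ℂ trigWeylRel.relXp

lemma p_mul_Xinv : p * Xinv = Xinv * p + Xinv := by
  calc p * Xinv = Xinv * (X * p) * Xinv := by rw [← mul_assoc, Xinv_mul_X, one_mul]
    _ = Xinv * p * (X * Xinv) + Xinv * (X * Xinv) := by
      rw [X_mul_p]
      noncomm_ring
    _ = _ := by rw [X_mul_Xinv, mul_one, mul_one]

@[elab_as_elim]
lemma induction {motive : TrigWeyl → Prop} (scalar : ∀ c : ℂ, motive (algebraMap ℂ TrigWeyl c))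
    (X : motive X) (Xinv : motive Xinv) (p : motive p)
    (mul : ∀ a b, motive a → motive b → motive (a * b))
    (add : ∀ a b, motive a → motive b → motive (a + b)) (a : TrigWeyl) : motive a := by
  obtain ⟨a, rfl⟩ := RingQuot.mkAlgHom_surjective ℂ trigWeylRel a
  induction a with
  | grade0 c => simpa using scalar c
  | grade1 i =>
    fin_cases i
    exacts [X, Xinv, p]
  | mul a b ha hb => simpa using mul _ _ ha hb
  | add a b ha hb => simpa using add _ _ ha hb

/-- The generator `X` as a unit. -/
def unitX : TrigWeylˣ := ⟨X, Xinv, X_mul_Xinv, Xinv_mul_X⟩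

@[simp] lemma val_unitX : (unitX : TrigWeyl) = X := rfl

@[simp] lemma val_inv_unitX : (unitX⁻¹ : TrigWeylˣ) = Xinv := rfl

lemma X_mul_zpow (k : ℤ) : X * (unitX ^ k : TrigWeylˣ) = (unitX ^ (k + 1) : TrigWeylˣ) := by
  rw [← val_unitX, ← Units.val_mul, ← zpow_one_add, add_comm]

lemma Xinv_mul_zpow (k : ℤ) : Xinv * (unitX ^ k : TrigWeylˣ) = (unitX ^ (k - 1) : TrigWeylˣ) := by
  rw [← val_inv_unitX, ← Units.val_mul, ← zpow_neg_one, ← zpow_add, neg_add_eq_sub]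

lemma p_mul_zpow (k : ℤ) : p * (unitX ^ k : TrigWeylˣ) =
    (unitX ^ k : TrigWeylˣ) * (p - algebraMap ℂ TrigWeyl k) := by
  induction k with
  | zero => simp
  | succ n ih =>
    have h : p * X = X * (p - 1) := by rw [mul_sub, X_mul_p, mul_one, add_sub_cancel_right]
    rw [zpow_add_one, Units.val_mul, val_unitX, ← mul_assoc, ih, mul_assoc, sub_mul, h,
      Algebra.commutes, mul_assoc, ← mul_sub]
    simp [sub_sub, add_comm]
  | pred n ih =>
    have h : p * Xinv = Xinv * (p + 1) := by rw [mul_add, p_mul_Xinv, mul_one]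
    rw [zpow_sub_one, Units.val_mul, val_inv_unitX, ← mul_assoc, ih, mul_assoc, sub_mul, h,
      Algebra.commutes, mul_assoc, ← mul_sub]
    congr 2
    simp
    abel

/-- The space of Laurent polynomials in `X` with coefficients polynomials in `p`. -/
abbrev NormalForm : Type := ℤ →₀ Polynomial ℂ

/-- The element `∑ X ^ k * f k (p)`. -/
def ofNormalForm : NormalForm →ₗ[ℂ] TrigWeyl :=
  Finsupp.lsum ℂ fun k =>
    LinearMap.mulLeft ℂ (unitX ^ k : TrigWeylˣ).val ∘ₗ (aeval p).toLinearMap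

@[simp] lemma ofNormalForm_single (k : ℤ) (f : Polynomial ℂ) :
    ofNormalForm (Finsupp.single k f) = (unitX ^ k : TrigWeylˣ) * aeval p f := by
  simp [ofNormalForm]

/-- The action of a power of `X` on normal forms. -/
def shift (j : ℤ) : Module.End ℂ NormalForm := Finsupp.lmapDomain _ ℂ (j + ·)

@[simp] lemma shift_single (j k : ℤ) (f : Polynomial ℂ) :
    shift j (Finsupp.single k f) = Finsupp.single (j + k) f := by
  simp [shift]

lemma shift_mul (i j : ℤ) : shift i * shift j = shift (i + j) := by
  refine Finsupp.lhom_ext fun k f => ?_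
  simp [add_assoc]

lemma shift_zero : shift 0 = 1 := by
  refine Finsupp.lhom_ext fun k f => ?_
  simp

/-- The action of `p` on normal forms. -/
def actionP : Module.End ℂ NormalForm :=
  Finsupp.lsum ℂ fun k => Finsupp.lsingle k ∘ₗ LinearMap.mulLeft ℂ (Polynomial.X - C (k : ℂ))

@[simp] lemma actionP_single (k : ℤ) (f : Polynomial ℂ) :
    actionP (Finsupp.single k f) = Finsupp.single k ((Polynomial.X - C (k : ℂ)) * f) := by
  simp [actionP]

/-- The action of the trigonometric Weyl algebra on normal forms by left multiplication. -/
def action : TrigWeyl →ₐ[ℂ] Module.End ℂ NormalForm :=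
  RingQuot.liftAlgHom ℂ ⟨FreeAlgebra.lift ℂ ![shift 1, shift (-1), actionP], by
    rintro _ _ (_ | _ | _)
    · simp [shift_mul, shift_zero]
    · simp [shift_mul, shift_zero]
    · simp only [map_mul, map_add, FreeAlgebra.lift_ι_apply]
      refine Finsupp.lhom_ext fun k f => ?_
      simp only [Matrix.cons_val, Module.End.mul_apply, LinearMap.add_apply, actionP_single,
        shift_single, ← Finsupp.single_add]
      congr 1
      simp
      ring⟩

@[simp] lemma action_X : action X = shift 1 := by
  simp [action, X]

@[simp] lemma action_Xinv : action Xinv = shift (-1) := by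
  simp [action, Xinv]

@[simp] lemma action_p : action p = actionP := by
  simp [action, p]

lemma ofNormalForm_action (a : TrigWeyl) (v : NormalForm) :
    ofNormalForm (action a v) = a * ofNormalForm v := by
  suffices ofNormalForm ∘ₗ action a = LinearMap.mulLeft ℂ a ∘ₗ ofNormalForm from congr($this v)
  induction a using induction with
  | scalar c =>
    refine LinearMap.ext fun v => ?_
    simp [Module.algebraMap_end_apply, Algebra.smul_def]
  | X =>
    refine Finsupp.lhom_ext fun k f => ?_
    simp [← mul_assoc, X_mul_zpow, add_comm]
  | Xinv =>
    refine Finsupp.lhom_ext fun k f => ?_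
    simp [← mul_assoc, Xinv_mul_zpow, sub_eq_neg_add]
  | p =>
    refine Finsupp.lhom_ext fun k f => ?_
    simp [← mul_assoc, p_mul_zpow, -Finsupp.single_mul]
  | mul a b ha hb =>
    rw [map_mul, Module.End.mul_eq_comp, ← LinearMap.comp_assoc, ha, LinearMap.comp_assoc, hb,
      LinearMap.mulLeft_mul, LinearMap.comp_assoc]
  | add a b ha hb =>
    refine LinearMap.ext fun v => ?_
    simpa [add_mul] using congr($ha v + $hb v)

lemma action_zpow (k : ℤ) : action (unitX ^ k : TrigWeylˣ) = shift k := by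
  induction k with
  | zero => simp [shift_zero]
  | succ n ih => rw [zpow_add_one, Units.val_mul, map_mul, ih, val_unitX, action_X, shift_mul]
  | pred n ih =>
    rw [zpow_sub_one, Units.val_mul, map_mul, ih, val_inv_unitX, action_Xinv, shift_mul,
      sub_eq_add_neg]

lemma aeval_actionP (f g : Polynomial ℂ) :
    aeval actionP f (Finsupp.single 0 g) = Finsupp.single 0 (f * g) := by
  induction f using Polynomial.induction_on' with
  | add f₁ f₂ h₁ h₂ => simp [h₁, h₂, add_mul]
  | monomial n c =>
    rw [← Polynomial.C_mul_X_pow_eq_monomial]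
    induction n generalizing g with
    | zero => simp [← Polynomial.smul_eq_C_mul]
    | succ n ih =>
      rw [pow_succ, ← mul_assoc, map_mul, Module.End.mul_apply, Polynomial.aeval_X, actionP_single,
        ih]
      simp [mul_assoc]

/-- Every element has a unique expression `∑ X ^ k * f k (p)`. -/
def normalForm : TrigWeyl ≃ₗ[ℂ] NormalForm :=
  LinearEquiv.ofLinearMap (LinearMap.applyₗ (Finsupp.single 0 1) ∘ₗ action.toLinearMap) ofNormalForm
    (by
      refine Finsupp.lhom_ext fun k f => ?_
      change action (ofNormalForm (Finsupp.single k f)) (Finsupp.single 0 1) = _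
      rw [ofNormalForm_single, map_mul, action_zpow, Module.End.mul_apply,
        ← Polynomial.aeval_algHom_apply, action_p, aeval_actionP]
      simp)
    (by
      ext a
      change ofNormalForm (action a (Finsupp.single 0 1)) = a
      simp [ofNormalForm_action])

@[simp] lemma normalForm_symm_apply (v : NormalForm) : normalForm.symm v = ofNormalForm v := rfl

@[simp] lemma normalForm_one : normalForm 1 = Finsupp.single 0 1 := by
  rw [← LinearEquiv.eq_symm_apply]
  simp

lemma normalForm_mul (a b : TrigWeyl) : normalForm (a * b) = action a (normalForm b) := by
  rw [← LinearEquiv.eq_symm_apply, normalForm_symm_apply, ofNormalForm_action,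
    ← normalForm_symm_apply, LinearEquiv.symm_apply_apply]

lemma normalForm_p_mul (b : TrigWeyl) (k : ℤ) :
    normalForm (p * b) k = (Polynomial.X - C (k : ℂ)) * normalForm b k := by
  rw [normalForm_mul, action_p]
  induction normalForm b using Finsupp.induction_linear with
  | zero => simp
  | add v w hv hw => simp [hv, hw, mul_add]
  | single j f =>
    rw [actionP_single]
    obtain rfl | h := eq_or_ne j k
    · simp
    · simp [Finsupp.single_eq_of_ne' h]

lemma normalForm_Xinv_mul (b : TrigWeyl) (k : ℤ) :
    normalForm (Xinv * b) k = normalForm b (k + 1) := by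
  rw [normalForm_mul, action_Xinv]
  exact (congrArg _ (neg_add_cancel_comm_assoc 1 k).symm).trans
    (Finsupp.mapDomain_apply (add_right_injective (-1)) _ _)

lemma sub_algebraMap_mul_sub_mul {A : Type} [Ring A] [Algebra ℂ A] (c : ℂ) (a b : A) :
    (a - algebraMap ℂ A c) * b - a * b = -c • b := by
  rw [← sub_mul, sub_sub_cancel_left, neg_mul, neg_smul, Algebra.smul_def]

lemma normalForm_p_comm (a : TrigWeyl) (k : ℤ) :
    normalForm (p * a - a * p) k = -(k : ℂ) • normalForm a k := by
  obtain ⟨v, rfl⟩ := normalForm.symm.surjective a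
  induction v using Finsupp.induction_linear with
  | zero => simp
  | add v w hv hw =>
    rw [map_add, mul_add, add_mul, add_sub_add_comm, map_add, map_add, Finsupp.add_apply, hv, hw,
      Finsupp.add_apply, smul_add]
  | single j f =>
    have h : aeval p f * p = p * aeval p f := by
      simpa only [map_mul, Polynomial.aeval_X] using
        congrArg (aeval p) (mul_comm f Polynomial.X)
    have : p * normalForm.symm (Finsupp.single j f) - normalForm.symm (Finsupp.single j f) * p =
        normalForm.symm (Finsupp.single j (-(j : ℂ) • f)) := by
      rw [normalForm_symm_apply, normalForm_symm_apply, ofNormalForm_single, ofNormalForm_single,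
        ← mul_assoc, p_mul_zpow, mul_assoc, mul_assoc, ← mul_sub, h, map_smul]
      exact congrArg _ (sub_algebraMap_mul_sub_mul (j : ℂ) p (aeval p f))
    rw [this, LinearEquiv.apply_symm_apply, LinearEquiv.apply_symm_apply]
    obtain rfl | h := eq_or_ne j k
    · simp
    · simp [Finsupp.single_eq_of_ne' h]

lemma aeval_p_mul_Xinv (f : Polynomial ℂ) :
    aeval p f * Xinv = Xinv * aeval p (taylor 1 f) := by
  induction f using Polynomial.induction_on' with
  | add f₁ f₂ h₁ h₂ => simp [h₁, h₂, add_mul, mul_add]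
  | monomial n c =>
    rw [← Polynomial.C_mul_X_pow_eq_monomial]
    induction n with
    | zero => simpa using Algebra.commutes c Xinv
    | succ n ih =>
      have h : p * Xinv = Xinv * (p + 1) := by rw [mul_add, p_mul_Xinv, mul_one]
      rw [pow_succ, ← mul_assoc, map_mul, Polynomial.aeval_X, mul_assoc, h, ← mul_assoc, ih,
        Polynomial.taylor_mul _ (C c * Polynomial.X ^ n)]
      simp [mul_assoc]

lemma normalForm_conj_X (a : TrigWeyl) (k : ℤ) :
    normalForm (X * a * Xinv) k = taylor 1 (normalForm a k) := by
  obtain ⟨v, rfl⟩ := normalForm.symm.surjective a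
  induction v using Finsupp.induction_linear with
  | zero => simp
  | add v w hv hw =>
    rw [map_add, mul_add, add_mul, map_add, map_add, Finsupp.add_apply, hv, hw, Finsupp.add_apply,
      map_add]
  | single j f =>
    have : X * normalForm.symm (Finsupp.single j f) * Xinv =
        normalForm.symm (Finsupp.single j (taylor 1 f)) := by
      rw [normalForm_symm_apply, normalForm_symm_apply, ofNormalForm_single, ofNormalForm_single,
        mul_assoc, mul_assoc, aeval_p_mul_Xinv, ← mul_assoc, ← mul_assoc, X_mul_zpow,
        ← val_inv_unitX, ← Units.val_mul, zpow_add_one, mul_inv_cancel_right]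
    rw [this, LinearEquiv.apply_symm_apply, LinearEquiv.apply_symm_apply]
    obtain rfl | h := eq_or_ne j k
    · simp
    · simp [Finsupp.single_eq_of_ne' h]

end TrigWeyl

/-- A finitely supported function with sum zero is a difference `k ↦ h (k + 1) - h k`. -/
lemma Finsupp.exists_sub_eq_of_sum_eq_zero {M : Type} [AddCommGroup M] (g : ℤ →₀ M)
    (hg : g.sum (fun _ m => m) = 0) : ∃ h : ℤ →₀ M, ∀ k, h (k + 1) - h k = g k := by
  let δ : (ℤ →₀ M) →+ (ℤ →₀ M) :=
    (Finsupp.domCongr (Equiv.subRight 1)).toAddMonoidHom - AddMonoidHom.id _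
  suffices g - Finsupp.single 0 (g.sum fun _ m => m) ∈ δ.range by
    rw [hg, Finsupp.single_zero, sub_zero] at this
    obtain ⟨h, rfl⟩ := this
    exact ⟨h, fun k => by simp [δ, Finsupp.equivMapDomain_apply]⟩
  clear hg
  have hδ : ∀ (n : ℤ) (m : M), Finsupp.single (n - 1) m - Finsupp.single n m ∈ δ.range := fun n m =>
    ⟨Finsupp.single n m, by simp [δ, Finsupp.equivMapDomain_single]⟩
  induction g using Finsupp.induction_linear with
  | zero => simp
  | add v w hv hw =>
    rw [Finsupp.sum_add_index (by simp) (by simp), Finsupp.single_add, add_sub_add_comm]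
    exact add_mem hv hw
  | single n m =>
    rw [Finsupp.sum_single_index rfl]
    induction n with
    | zero => simp
    | succ n ih =>
      have := sub_mem ih (hδ (n + 1) m)
      simpa using this
    | pred n ih =>
      have := add_mem ih (hδ (-n) m)
      simpa using this

lemma Finsupp.eq_zero_of_apply_add_one {M : Type} [AddCommGroup M] (g : ℤ →₀ M)
    (hg : ∀ k, g (k + 1) = g k) : g = 0 := by
  have h : ∀ k, g k = g 0 := fun k => by
    induction k with
    | zero => rfl
    | succ n ih => rw [hg, ih]
    | pred n ih => rw [← ih, ← hg, sub_add_cancel]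
  obtain ⟨k, hk⟩ := Infinite.exists_notMem_finset g.support
  ext j
  rw [h, ← h k, Finsupp.notMem_support_iff.mp hk, Finsupp.zero_apply]

/-- A ring with the defining properties of the trigonometric Weyl algebra: every element is
uniquely a sum `∑ u ^ k * f k (p)`, and the coefficients `f k` transform as they should. -/
structure LaurentForm (A : Type) [Ring A] [Algebra ℂ A] where
  /-- The invertible generator. -/
  u : Aˣ
  /-- The other generator. -/
  p : A
  /-- The coefficients of an element. -/
  form : A ≃ₗ[ℂ] (ℤ →₀ Polynomial ℂ)
  form_one : form 1 = Finsupp.single 0 1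
  form_p_mul : ∀ b k, form (p * b) k = (Polynomial.X - Polynomial.C (k : ℂ)) * form b k
  form_inv_mul : ∀ b k, form ((u⁻¹ : Aˣ) * b) k = form b (k + 1)
  form_comm : ∀ a k, form (p * a - a * p) k = -(k : ℂ) • form a k
  form_conj : ∀ a k, form (u * a * (u⁻¹ : Aˣ)) k = Polynomial.taylor 1 (form a k)
  p_mul_zpow : ∀ k : ℤ, p * (u ^ k : Aˣ) = (u ^ k : Aˣ) * (p - algebraMap ℂ A k)
  eq_top : ∀ S : Subalgebra ℂ A, (u : A) ∈ S → ((u⁻¹ : Aˣ) : A) ∈ S → p ∈ S → S = ⊤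

namespace LaurentForm

open Polynomial (C taylor)

variable {A : Type} [Ring A] [Algebra ℂ A] (L : LaurentForm A)

lemma u_mul_zpow (k : ℤ) : L.u * (L.u ^ k : Aˣ).val = (L.u ^ (k + 1) : Aˣ) := by
  rw [← Units.val_mul, ← zpow_one_add, add_comm]

lemma u_mul_p : L.u * L.p = L.p * L.u + L.u := by
  have := L.p_mul_zpow 1
  simp only [zpow_one, Int.cast_one, map_one, mul_sub, mul_one] at this
  rw [this, sub_add_cancel]

lemma p_mul_inv : L.p * (L.u⁻¹ : Aˣ) = (L.u⁻¹ : Aˣ) * L.p + (L.u⁻¹ : Aˣ) := by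
  simpa [mul_add] using L.p_mul_zpow (-1)

/-- Multiplication of the `k`-th coefficient by the `k`-th power of `X`. -/
def twist : (ℤ →₀ Polynomial A) ≃ₗ[ℂ] (ℤ →₀ Polynomial A) where
  toFun g := Finsupp.onFinset g.support (fun k => g k * C (L.u ^ k : Aˣ).val)
    fun k hk => by
      rw [Finsupp.mem_support_iff]
      exact left_ne_zero_of_mul hk
  invFun g := Finsupp.onFinset g.support (fun k => g k * C (L.u ^ (-k) : Aˣ).val)
    fun k hk => by
      rw [Finsupp.mem_support_iff]
      exact left_ne_zero_of_mul hk
  map_add' g h := by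
    ext1 k
    simp [add_mul]
  map_smul' c g := by
    ext1 k
    simp
  left_inv g := by
    ext1 k
    simp only [Finsupp.onFinset_apply]
    rw [mul_assoc, ← Polynomial.C_mul, ← Units.val_mul, ← zpow_add, add_neg_cancel]
    simp
  right_inv g := by
    ext1 k
    simp only [Finsupp.onFinset_apply]
    rw [mul_assoc, ← Polynomial.C_mul, ← Units.val_mul, ← zpow_add, neg_add_cancel]
    simp

lemma twist_apply (g : ℤ →₀ Polynomial A) (k : ℤ) :
    L.twist g k = g k * C (L.u ^ k : Aˣ).val := rfl

/-- Coordinates on the enveloping algebra in which right multiplication by `X ⊗ X⁻¹` is a shift. -/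
def envForm : env A ≃ₗ[ℂ] (ℤ →₀ Polynomial A) :=
  TensorProduct.congr (LinearEquiv.refl ℂ A) ((opLinearEquiv ℂ).symm ≪≫ₗ L.form) ≪≫ₗ
    TensorProduct.finsuppRight ℂ ℂ A (Polynomial ℂ) ℤ ≪≫ₗ
    Finsupp.mapRange.linearEquiv (polyEquivTensor ℂ A).symm.toLinearEquiv ≪≫ₗ L.twist

lemma envForm_tmul (a b : A) (k : ℤ) :
    L.envForm (a ⊗ₜ op b) k = C a * (L.form b k).map (algebraMap ℂ A) *
      C (L.u ^ k : Aˣ).val := by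
  simp [envForm, twist_apply, Polynomial.smul_eq_C_mul]

/-- The element `X ⊗ X⁻¹ - 1` of the enveloping algebra. -/
def envS : env A := L.u.val ⊗ₜ op ((L.u⁻¹ : Aˣ) : A) - 1

/-- The element `p ⊗ 1 - 1 ⊗ p` of the enveloping algebra. -/
def envW : env A := L.p ⊗ₜ 1 - 1 ⊗ₜ op L.p

lemma envS_mul_envW : L.envS * L.envW = L.envW * L.envS := by
  have h : (L.u.val ⊗ₜ op ((L.u⁻¹ : Aˣ) : A) : env A) * L.envW = L.envW * (L.u.val ⊗ₜ op ((L.u⁻¹ : Aˣ) : A)) := by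
    simp only [envW, mul_sub, sub_mul, Algebra.TensorProduct.tmul_mul_tmul, mul_one, one_mul,
      ← op_mul, L.u_mul_p, L.p_mul_inv, MulOpposite.op_add, TensorProduct.add_tmul, TensorProduct.tmul_add]
    abel
  rw [envS, sub_mul, mul_sub, h, one_mul, mul_one]

lemma map_mul_C_comm (f : Polynomial ℂ) (a : A) :
    f.map (algebraMap ℂ A) * C a = C a * f.map (algebraMap ℂ A) := by
  ext n
  simp [Algebra.commutes]

lemma envForm_mul_envS (x : env A) (k : ℤ) :
    L.envForm (x * L.envS) k = L.envForm x (k + 1) - L.envForm x k := by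
  rw [envS, mul_sub, mul_one, map_sub, Finsupp.sub_apply]
  congr 1
  induction x using TensorProduct.induction_on with
  | zero => simp
  | add x y hx hy =>
    rw [add_mul, map_add, Finsupp.add_apply, hx, hy, map_add L.envForm x y, Finsupp.add_apply]
  | tmul a b =>
    obtain ⟨b, rfl⟩ := op_surjective b
    rw [Algebra.TensorProduct.tmul_mul_tmul, ← op_mul, L.envForm_tmul, L.envForm_tmul,
      L.form_inv_mul, ← L.u_mul_zpow, Polynomial.C_mul, Polynomial.C_mul, mul_assoc (C a),
      ← map_mul_C_comm]
    simp only [mul_assoc]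

lemma envForm_mul_envW (x : env A) (k : ℤ) :
    L.envForm (x * L.envW) k = L.envForm x k * (C L.p - Polynomial.X) := by
  induction x using TensorProduct.induction_on with
  | zero => simp
  | add x y hx hy =>
    rw [add_mul, map_add, map_add, Finsupp.add_apply, hx, hy, Finsupp.add_apply, add_mul]
  | tmul a b =>
    obtain ⟨b, rfl⟩ := op_surjective b
    have h₁ : C L.p * C (L.u ^ k : Aˣ).val =
        C (L.u ^ k : Aˣ).val * (C L.p - C (algebraMap ℂ A k)) := by
      rw [← Polynomial.C_mul, L.p_mul_zpow, Polynomial.C_mul, Polynomial.C_sub]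
    have h₂ : C (algebraMap ℂ A k) * C (L.u ^ k : Aˣ).val =
        C (L.u ^ k : Aˣ).val * C (algebraMap ℂ A k) := by
      rw [← Polynomial.C_mul, Algebra.commutes, Polynomial.C_mul]
    rw [envW, mul_sub, Algebra.TensorProduct.tmul_mul_tmul, Algebra.TensorProduct.tmul_mul_tmul,
      ← op_mul, mul_one, mul_one, map_sub, Finsupp.sub_apply, L.envForm_tmul, L.envForm_tmul,
      L.envForm_tmul, L.form_p_mul, mul_comm (Polynomial.X - _), Polynomial.C_mul]
    simp only [Polynomial.map_mul, Polynomial.map_sub, Polynomial.map_X, Polynomial.map_C]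
    rw [mul_assoc (C a), ← map_mul_C_comm]
    generalize (L.form b k).map (algebraMap ℂ A) = f
    simp only [mul_assoc, sub_mul, mul_sub, h₁, h₂, Polynomial.X_mul]
    abel

lemma eq_zero_of_mul_envS (x : env A) (hx : x * L.envS = 0) : x = 0 := by
  rw [← LinearEquiv.map_eq_zero_iff L.envForm]
  refine Finsupp.eq_zero_of_apply_add_one _ fun k => ?_
  rw [← sub_eq_zero, ← L.envForm_mul_envS, hx, map_zero, Finsupp.zero_apply]

lemma exists_eq_mul_envS (x y : env A) (h : x * L.envW = y * L.envS) :
    ∃ z, x = z * L.envS := by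
  have hsum : (L.envForm x).sum (fun _ f => f) * (C L.p - Polynomial.X) = 0 := by
    let T : (ℤ →₀ Polynomial A) →+ Polynomial A :=
      Finsupp.liftAddHom fun _ => AddMonoidHom.id _
    let F : Polynomial A →+ Polynomial A := AddMonoidHom.mulRight (C L.p - Polynomial.X)
    have hw : L.envForm (x * L.envW) = Finsupp.mapRange F F.map_zero (L.envForm x) :=
      Finsupp.ext fun k => L.envForm_mul_envW x k
    have hs : L.envForm (y * L.envS) =
        Finsupp.domCongr (Equiv.subRight 1) (L.envForm y) - L.envForm y :=
      Finsupp.ext fun k => by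
        simp [envForm_mul_envS, Finsupp.equivMapDomain_apply]
    have hT : T (Finsupp.domCongr (Equiv.subRight 1) (L.envForm y)) = T (L.envForm y) := by
      simp [T, Finsupp.sum_equivMapDomain]
      rfl
    calc _ = T (L.envForm (x * L.envW)) := by
          rw [hw]
          simp [T, F, Finsupp.sum_mapRange_index, Finsupp.sum_mul]
      _ = 0 := by rw [h, hs, map_sub, hT, sub_self]
  have hzero : (L.envForm x).sum (fun _ f => f) = 0 := by
    rwa [← neg_sub, mul_neg, neg_eq_zero, (Polynomial.monic_X_sub_C L.p).mul_left_eq_zero_iff] at hsum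
  obtain ⟨g, hg⟩ := Finsupp.exists_sub_eq_of_sum_eq_zero _ hzero
  refine ⟨L.envForm.symm g, L.envForm.injective (Finsupp.ext fun k => ?_)⟩
  rw [L.envForm_mul_envS, LinearEquiv.apply_symm_apply, hg]

end LaurentForm

namespace Polynomial

/-- The difference operator `f ↦ f (X + 1) - f` is surjective. -/
lemma exists_taylor_one_sub_eq (f : Polynomial ℂ) : ∃ h, taylor 1 h - h = f := by
  suffices f ∈ LinearMap.range (taylor (R := ℂ) 1 - LinearMap.id) from this
  induction f using Polynomial.induction_on' with
  | add f g hf hg => exact add_mem hf hg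
  | monomial n c =>
    rw [← mul_one c, ← smul_eq_mul, ← smul_monomial]
    refine Submodule.smul_mem _ _ ⟨(n + 1 : ℂ)⁻¹ • (bernoulli (n + 1)).map (algebraMap ℚ ℂ), ?_⟩
    have h := congrArg (Polynomial.map (algebraMap ℚ ℂ)) (bernoulli_comp_one_add_X (n + 1))
    have hn : (n + 1 : ℂ) ≠ 0 := Nat.cast_add_one_ne_zero n
    simp only [Polynomial.map_comp, Polynomial.map_add, Polynomial.map_one, Polynomial.map_X,
      Nat.add_sub_cancel] at h
    have h' : ((n + 1) • X ^ n : Polynomial ℚ).map (algebraMap ℚ ℂ) =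
        (n + 1 : ℂ) • monomial n (1 : ℂ) := by
      rw [nsmul_eq_mul, smul_eq_C_mul, Polynomial.map_mul, ← X_pow_eq_monomial]
      simp
    rw [add_comm 1 X, h'] at h
    rw [LinearMap.sub_apply, LinearMap.id_apply, map_smul, taylor_apply, C_1, h, smul_add,
      add_sub_cancel_left, smul_smul, inv_mul_cancel₀ hn, one_smul]

/-- A polynomial invariant under translation by `1` is constant. -/
lemma eq_C_of_taylor_one_eq {f : Polynomial ℂ} (hf : taylor 1 f = f) : f = C (f.coeff 0) := by
  have h : ∀ n : ℕ, f.eval (n : ℂ) = f.eval 0 := fun n => by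
    induction n with
    | zero => simp
    | succ n ih => rw [← ih, Nat.cast_succ, ← taylor_eval, hf]
  refine eq_of_infinite_eval_eq _ _ ((Set.infinite_range_of_injective
    (Nat.cast_injective (R := ℂ))).mono ?_)
  rintro _ ⟨n, rfl⟩
  simp [h, coeff_zero_eq_eval_zero]

end Polynomial

namespace LaurentForm

open Polynomial (C taylor)

variable {A : Type} [Ring A] [Algebra ℂ A] (L : LaurentForm A)

attribute [local instance] TensorProduct.Algebra.module

/-- The augmentation of the enveloping algebra. -/
def augmentation (A : Type) [Ring A] [Algebra ℂ A] : env A →ₗ[env A] A :=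
  LinearMap.toSpanSingleton (env A) A 1

lemma augmentation_tmul (a b : A) : augmentation A (a ⊗ₜ op b) = a * b := by
  simp [augmentation, TensorProduct.Algebra.smul_def]

lemma augmentation_surjective : Function.Surjective (augmentation A) := fun a =>
  ⟨a ⊗ₜ op 1, by rw [augmentation_tmul, mul_one]⟩

lemma envS_smul (a : A) : L.envS • a = L.u * a * (L.u⁻¹ : Aˣ) - a := by
  simp [envS, sub_smul, TensorProduct.Algebra.smul_def, mul_assoc]

lemma envW_smul (a : A) : L.envW • a = L.p * a - a * L.p := by
  simp [envW, sub_smul, TensorProduct.Algebra.smul_def]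

lemma augmentation_envS : augmentation A L.envS = 0 := by
  simp [augmentation, envS_smul]

lemma augmentation_envW : augmentation A L.envW = 0 := by
  simp [augmentation, envW_smul]

lemma form_envS_smul (a : A) (k : ℤ) :
    L.form (L.envS • a) k = taylor 1 (L.form a k) - L.form a k := by
  rw [envS_smul, map_sub, Finsupp.sub_apply, form_conj]

lemma form_envW_smul (a : A) (k : ℤ) : L.form (L.envW • a) k = -(k : ℂ) • L.form a k := by
  rw [envW_smul, form_comm]

/-- The elements `a` such that `a ⊗ 1 - 1 ⊗ a` lies in a given left ideal of `env A`. -/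
def commutatorSubalgebra (J : Submodule (env A) (env A)) : Subalgebra ℂ A where
  carrier := {a | (a ⊗ₜ 1 - 1 ⊗ₜ op a : env A) ∈ J}
  mul_mem' {a b} ha hb := by
    have h : ((a * b) ⊗ₜ 1 - 1 ⊗ₜ op (a * b) : env A) =
        (a ⊗ₜ 1 : env A) • (b ⊗ₜ 1 - 1 ⊗ₜ op b : env A) +
          (1 ⊗ₜ op b : env A) • (a ⊗ₜ 1 - 1 ⊗ₜ op a : env A) := by
      simp [mul_sub]
    rw [Set.mem_ofPred_eq, h]
    exact add_mem (J.smul_mem _ hb) (J.smul_mem _ ha)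
  add_mem' {a b} ha hb := by
    have h : ((a + b) ⊗ₜ 1 - 1 ⊗ₜ op (a + b) : env A) =
        (a ⊗ₜ 1 - 1 ⊗ₜ op a) + (b ⊗ₜ 1 - 1 ⊗ₜ op b) := by
      rw [TensorProduct.add_tmul, MulOpposite.op_add, TensorProduct.tmul_add]
      abel
    rw [Set.mem_ofPred_eq, h]
    exact add_mem ha hb
  algebraMap_mem' c := by
    rw [Set.mem_ofPred_eq, Algebra.algebraMap_eq_smul_one, op_smul, TensorProduct.smul_tmul, op_one,
      sub_self]
    exact J.zero_mem

lemma exists_of_augmentation_eq_zero (x : env A) (hx : augmentation A x = 0) :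
    ∃ y z, y * L.envS + z * L.envW = x := by
  let J : Submodule (env A) (env A) := Submodule.span (env A) {L.envS, L.envW}
  suffices x ∈ J from Submodule.mem_span_pair.mp this
  have hS : L.envS ∈ J := Submodule.subset_span (by simp)
  have hW : L.envW ∈ J := Submodule.subset_span (by simp)
  have htop : commutatorSubalgebra J = ⊤ := by
    refine L.eq_top _ ?_ ?_ hW
    · have h : (L.u.val ⊗ₜ 1 - 1 ⊗ₜ op L.u.val : env A) = (1 ⊗ₜ op L.u.val : env A) • L.envS := by
        simp [envS, mul_sub, ← op_mul]
      change (_ : env A) ∈ J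
      rw [h]
      exact J.smul_mem _ hS
    · have h : (1 ⊗ₜ op (L.u⁻¹ : Aˣ).val - (L.u⁻¹ : Aˣ).val ⊗ₜ 1 : env A) =
          ((L.u⁻¹ : Aˣ).val ⊗ₜ 1 : env A) • L.envS := by
        simp [envS, mul_sub]
      change (_ : env A) ∈ J
      rw [sub_mem_comm_iff, h]
      exact J.smul_mem _ hS
  have key : ∀ x : env A, x - augmentation A x ⊗ₜ op 1 ∈ J := fun x => by
    induction x using TensorProduct.induction_on with
    | zero => simp
    | add x y hx hy =>
      rw [map_add, TensorProduct.add_tmul, add_sub_add_comm]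
      exact add_mem hx hy
    | tmul a b =>
      obtain ⟨b, rfl⟩ := op_surjective b
      have hb : b ∈ commutatorSubalgebra J := htop ▸ Algebra.mem_top
      have h : ((a * b) ⊗ₜ op 1 - a ⊗ₜ op b : env A) =
          (a ⊗ₜ 1 : env A) • (b ⊗ₜ 1 - 1 ⊗ₜ op b : env A) := by
        simp [mul_sub]
      rw [augmentation_tmul, sub_mem_comm_iff, h]
      exact J.smul_mem _ hb
  simpa [hx] using key x

/-- The Koszul resolution of `A` as a bimodule. -/
def resolution : ProjectiveResolution (envBimod A) :=
  Koszul.resolution L.envS_mul_envW (augmentation A) augmentation_surjective L.augmentation_envS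
    L.augmentation_envW L.exists_of_augmentation_eq_zero L.eq_zero_of_mul_envS
    L.exists_eq_mul_envS

/-- Hochschild cohomology is computed by the Koszul cochain complex. -/
def cohomologyIso (i : ℕ) :
    HHcoh A i ≅ (Koszul.cochains L.envS_mul_envW A).homology i :=
  L.resolution.isoExt (R := ℂ) i (envBimod A)

/-- The constant term of the normal form. -/
def constantTerm : A →+ ℂ :=
  ((Polynomial.lcoeff ℂ 0 ∘ₗ Finsupp.lapply 0) ∘ₗ L.form.toLinearMap).toAddMonoidHom

lemma constantTerm_apply (a : A) : L.constantTerm a = (L.form a 0).coeff 0 := rfl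

lemma constantTerm_smul (c : ℂ) (a : A) :
    L.constantTerm (algebraMap ℂ (env A) c • a) = c * L.constantTerm a := by
  have h : algebraMap ℂ (env A) c • a = c • a := by
    rw [Algebra.TensorProduct.algebraMap_apply, TensorProduct.Algebra.smul_def, one_smul,
      algebraMap_smul]
  rw [h, constantTerm_apply, constantTerm_apply, map_smul, Finsupp.smul_apply,
    Polynomial.coeff_smul, smul_eq_mul]

/-- Division of the `k`-th coefficient by `-k`, and removal of the zeroth. -/
def divideW (a : A) : A :=
  L.form.symm (Finsupp.onFinset (L.form a).support (fun k => -(k : ℂ)⁻¹ • L.form a k) fun k hk => by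
    rw [Finsupp.mem_support_iff]
    exact right_ne_zero_of_smul hk)

lemma form_divideW (a : A) (k : ℤ) : L.form (L.divideW a) k = -(k : ℂ)⁻¹ • L.form a k := by
  rw [divideW, LinearEquiv.apply_symm_apply, Finsupp.onFinset_apply]

lemma smul_form_divideW (a : A) {k : ℤ} (hk : k ≠ 0) :
    -(k : ℂ) • L.form (L.divideW a) k = L.form a k := by
  rw [form_divideW, smul_smul, neg_mul_neg, mul_inv_cancel₀ (Int.cast_ne_zero.mpr hk), one_smul]

lemma form_symm_single_zero (f : Polynomial ℂ) {k : ℤ} (hk : k ≠ 0) :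
    L.form (L.form.symm (Finsupp.single 0 f)) k = 0 := by
  rw [LinearEquiv.apply_symm_apply, Finsupp.single_eq_of_ne hk]

lemma form_symm_single_zero_zero (f : Polynomial ℂ) :
    L.form (L.form.symm (Finsupp.single 0 f)) 0 = f := by
  rw [LinearEquiv.apply_symm_apply, Finsupp.single_eq_same]

lemma envS_smul_one : L.envS • (1 : A) = 0 := by
  simp [envS_smul]

lemma envW_smul_one : L.envW • (1 : A) = 0 := by
  simp [envW_smul]

lemma constantTerm_one : L.constantTerm 1 = 1 := by
  simp [constantTerm_apply, form_one]

lemma ext {a b : A} (h : ∀ k, L.form a k = L.form b k) : a = b :=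
  L.form.injective (Finsupp.ext h)

theorem nonempty_HHcoh_zero_iso (L : LaurentForm A) : Nonempty (HHcoh A 0 ≅ ModuleCat.of ℂ ℂ) := by
  refine (Koszul.nonempty_homology_zero_iso L.envS_mul_envW L.constantTerm L.constantTerm_smul ?_
    ⟨1, L.envS_smul_one, L.envW_smul_one, L.constantTerm_one⟩).map (L.cohomologyIso 0).trans
  intro n hs hw hl
  refine L.ext fun k => ?_
  rw [map_zero, Finsupp.zero_apply]
  obtain rfl | hk := eq_or_ne k 0
  · have h := L.form_envS_smul n 0
    rw [hs, map_zero L.form, Finsupp.zero_apply, eq_comm, sub_eq_zero] at h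
    rw [Polynomial.eq_C_of_taylor_one_eq h, ← constantTerm_apply, hl, Polynomial.C_0]
  · have h := L.form_envW_smul n k
    rw [hw, map_zero, Finsupp.zero_apply, eq_comm] at h
    simpa [hk] using h

theorem nonempty_HHcoh_one_iso (L : LaurentForm A) : Nonempty (HHcoh A 1 ≅ ModuleCat.of ℂ ℂ) := by
  refine (Koszul.nonempty_homology_one_iso L.envS_mul_envW L.constantTerm L.constantTerm_smul ?_ ?_
    ⟨0, 1, by rw [L.envS_smul_one, smul_zero], L.constantTerm_one⟩).map (L.cohomologyIso 1).trans
  · intro n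
    rw [constantTerm_apply, form_envW_smul]
    simp
  · intro a b hab hl
    have h : ∀ k : ℤ, -(k : ℂ) • L.form a k = taylor 1 (L.form b k) - L.form b k := fun k => by
      rw [← form_envW_smul, ← form_envS_smul, hab]
    obtain ⟨f, hf⟩ := Polynomial.exists_taylor_one_sub_eq (L.form a 0)
    have hb : L.form b 0 = 0 := by
      have h₀ := h 0
      rw [Int.cast_zero, neg_zero, zero_smul, eq_comm, sub_eq_zero] at h₀
      rw [Polynomial.eq_C_of_taylor_one_eq h₀, ← constantTerm_apply, hl, Polynomial.C_0]
    refine ⟨L.divideW b + L.form.symm (Finsupp.single 0 f), L.ext fun k => ?_, L.ext fun k => ?_⟩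
    · rw [form_envS_smul, map_add, Finsupp.add_apply]
      obtain rfl | hk := eq_or_ne k 0
      · rw [form_divideW, hb, smul_zero, zero_add, form_symm_single_zero_zero, hf]
      · rw [form_symm_single_zero L f hk, add_zero, form_divideW, map_smul, ← smul_sub, ← h,
          smul_smul, neg_mul_neg, inv_mul_cancel₀ (Int.cast_ne_zero.mpr hk), one_smul]
    · rw [form_envW_smul, map_add, Finsupp.add_apply]
      obtain rfl | hk := eq_or_ne k 0
      · rw [hb, Int.cast_zero, neg_zero, zero_smul]
      · rw [form_symm_single_zero L f hk, add_zero, smul_form_divideW L b hk]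

theorem isZero_HHcoh_add_two (L : LaurentForm A) (i : ℕ) : Limits.IsZero (HHcoh A (i + 2)) := by
  refine Limits.IsZero.of_iso ?_ (L.cohomologyIso (i + 2))
  match i with
  | i + 1 => exact Koszul.isZero_homology_add_three L.envS_mul_envW i
  | 0 =>
    refine Koszul.isZero_homology_two L.envS_mul_envW fun n => ?_
    obtain ⟨f, hf⟩ := Polynomial.exists_taylor_one_sub_eq (L.form n 0)
    refine ⟨L.divideW n, -L.form.symm (Finsupp.single 0 f), L.ext fun k => ?_⟩
    rw [smul_neg, sub_neg_eq_add, map_add, Finsupp.add_apply, form_envW_smul, form_envS_smul]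
    obtain rfl | hk := eq_or_ne k 0
    · rw [Int.cast_zero, neg_zero, zero_smul, zero_add, form_symm_single_zero_zero, hf]
    · rw [form_symm_single_zero L f hk, map_zero, sub_zero, add_zero, smul_form_divideW L n hk]

end LaurentForm

namespace TrigWeyl

/-- The normal form of elements of the trigonometric Weyl algebra. -/
def laurentForm : LaurentForm TrigWeyl where
  u := unitX
  p := p
  form := normalForm
  form_one := normalForm_one
  form_p_mul := normalForm_p_mul
  form_inv_mul := normalForm_Xinv_mul
  form_comm := normalForm_p_comm
  form_conj := normalForm_conj_X
  p_mul_zpow := p_mul_zpow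
  eq_top S hX hXinv hp := by
    refine Algebra.eq_top_iff.mpr fun a => ?_
    induction a using induction with
    | scalar c => exact S.algebraMap_mem c
    | X => exact hX
    | Xinv => exact hXinv
    | p => exact hp
    | mul a b ha hb => exact S.mul_mem ha hb
    | add a b ha hb => exact S.add_mem ha hb

end TrigWeyl

/-- The Hochschild cohomology of the trigonometric Weyl algebra `𝔸`
satisfies `HH^0(𝔸) ≅ ℂ`, `HH^1(𝔸) ≅ ℂ`, and `HH^i(𝔸) = 0` for `i ≠ 0, 1`. -/
theorem statement14 :
    Nonempty (HHcoh TrigWeyl 0 ≅ ModuleCat.of ℂ ℂ) ∧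
    Nonempty (HHcoh TrigWeyl 1 ≅ ModuleCat.of ℂ ℂ) ∧
    ∀ i : ℕ, i ≠ 0 → i ≠ 1 → Limits.IsZero (HHcoh TrigWeyl i) := by
  refine ⟨TrigWeyl.laurentForm.nonempty_HHcoh_zero_iso,
    TrigWeyl.laurentForm.nonempty_HHcoh_one_iso, fun i h₀ h₁ => ?_⟩
  match i with
  | 0 => exact absurd rfl h₀
  | 1 => exact absurd rfl h₁
  | i + 2 => exact TrigWeyl.laurentForm.isZero_HHcoh_add_two i
end
end
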